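/- There is an absolute constant C > 0 such that for every real x ≥ 4, | ∑_{√x < p ≤ x} 1/p² − 2/(√x log x) | ≤ C/(√x (log x)²), where the sum runs over primes p with √x < p ≤ x. -/

import Mathlib

open Filter Real Set

/-- The `n`-th term of the series for `(s - 1) ζ(s) - 1` valid for `0 < re s`. -/
noncomputable def zetaRegTerm (n : ℕ) (s : ℂ) : ℂ :=
  (s - 1) * ((n + 1 : ℝ) : ℂ) ^ (-s) + ((n + 2 : ℝ) : ℂ) ^ (1 - s) - ((n + 1 : ℝ) : ℂ) ^ (1 - s)

/-- The analytic continuation of `(s - 1) ζ(s)` to `1 - 1/64 < re s`. -/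
noncomputable def zetaReg (s : ℂ) : ℂ := 1 + ∑' n, zetaRegTerm n s

lemma hasDerivAt_ofReal_cpow_const_pos {x : ℝ} (hx : 0 < x) (r : ℂ) :
    HasDerivAt (fun y : ℝ => (y : ℂ) ^ r) (r * (x : ℂ) ^ (r - 1)) x := by
  have h := (HasDerivAt.cpow_const (c := r) (hasDerivAt_id (x : ℂ)) (Or.inl (by simpa using hx)))
  simpa using h.comp_ofReal

lemma norm_cpow_sub_cpow_le {s : ℂ} (hs : 0 ≤ s.re) {m u : ℝ} (hm : 0 < m)
    (hu : u ∈ Icc m (m + 1)) :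
    ‖(m : ℂ) ^ (-s) - (u : ℂ) ^ (-s)‖ ≤ ‖s‖ * m ^ (-s.re - 1) := by
  have h := norm_image_sub_le_of_norm_deriv_le_segment' (f := fun y : ℝ => (y : ℂ) ^ (-s))
    (f' := fun x : ℝ => (-s) * (x : ℂ) ^ (-s - 1)) (a := m) (b := m + 1)
    (C := ‖s‖ * m ^ (-s.re - 1))
    (fun x hx => (hasDerivAt_ofReal_cpow_const_pos (hm.trans_le hx.1) (-s)).hasDerivWithinAt)
    (fun x hx => by
      rw [norm_mul, norm_neg, Complex.norm_cpow_eq_rpow_re_of_pos (hm.trans_le hx.1)]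
      simp only [Complex.sub_re, Complex.neg_re, Complex.one_re]
      exact mul_le_mul_of_nonneg_left
        (Real.rpow_le_rpow_of_nonpos hm hx.1 (by linarith)) (norm_nonneg _)) u hu
  rw [norm_sub_rev]
  refine h.trans ?_
  have : u - m ≤ 1 := by linarith [hu.2]
  exact mul_le_of_le_one_right (by positivity) this

lemma norm_cpow_sub_cpow_le_interp {s : ℂ} (hs : 0 ≤ s.re) {m u : ℝ} (hm : 0 < m)
    (hu : u ∈ Icc m (m + 1)) {θ : ℝ} (h0 : 0 ≤ θ) (h1 : θ ≤ 1) :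
    ‖(m : ℂ) ^ (-s) - (u : ℂ) ^ (-s)‖ ≤ 2 * ‖s‖ ^ θ * m ^ (-s.re - θ) := by
  set D := ‖(m : ℂ) ^ (-s) - (u : ℂ) ^ (-s)‖ with hD
  have hD0 : 0 ≤ D := norm_nonneg _
  have e1 : D ≤ 2 * m ^ (-s.re) := by
    refine (norm_sub_le _ _).trans ?_
    rw [Complex.norm_cpow_eq_rpow_re_of_pos hm,
      Complex.norm_cpow_eq_rpow_re_of_pos (hm.trans_le hu.1)]
    have := Real.rpow_le_rpow_of_nonpos hm hu.1 (by linarith : -s.re ≤ 0)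
    simp only [Complex.neg_re]
    linarith
  have e2 := norm_cpow_sub_cpow_le hs hm hu
  have e3 : D = D ^ (1 - θ) * D ^ θ := by
    rw [← Real.rpow_add_of_nonneg hD0 (by linarith) h0]; simp
  rw [e3]
  calc D ^ (1 - θ) * D ^ θ
      ≤ (2 * m ^ (-s.re)) ^ (1 - θ) * (‖s‖ * m ^ (-s.re - 1)) ^ θ := by
        gcongr
    _ = 2 ^ (1 - θ) * ‖s‖ ^ θ * m ^ (-s.re - θ) := by
        rw [Real.mul_rpow (by norm_num) (by positivity),
          Real.mul_rpow (by positivity) (by positivity), ← Real.rpow_mul hm.le,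
          ← Real.rpow_mul hm.le]
        have : m ^ (-s.re - θ) = m ^ (-s.re * (1 - θ)) * m ^ ((-s.re - 1) * θ) := by
          rw [← Real.rpow_add hm]; congr 1; ring
        rw [this]; ring
    _ ≤ _ := by
        gcongr
        calc (2 : ℝ) ^ (1 - θ) ≤ 2 ^ (1 : ℝ) :=
              Real.rpow_le_rpow_of_exponent_le (by norm_num) (by linarith)
          _ = 2 := by simp

lemma norm_zetaRegTerm_le {s : ℂ} (hs : 1 - 1 / 64 ≤ s.re) (n : ℕ) :
    ‖zetaRegTerm n s‖ ≤ 2 * ‖s - 1‖ * ‖s‖ ^ (1 / 32 : ℝ) * (n + 1 : ℝ) ^ (-(65 / 64) : ℝ) := by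
  set m : ℝ := n + 1 with hm
  have hm0 : 0 < m := by positivity
  have hm1 : 1 ≤ m := by rw [hm]; linarith [(Nat.cast_nonneg n : (0 : ℝ) ≤ n)]
  have hs0 : 0 ≤ s.re := by linarith
  have h := norm_image_sub_le_of_norm_deriv_le_segment'
    (f := fun y : ℝ => (s - 1) * (((y - m : ℝ) : ℂ) * (m : ℂ) ^ (-s)) + (y : ℂ) ^ (1 - s))
    (f' := fun x : ℝ => (s - 1) * (1 * (m : ℂ) ^ (-s)) + (1 - s) * (x : ℂ) ^ (1 - s - 1))
    (a := m) (b := m + 1)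
    (C := ‖s - 1‖ * (2 * ‖s‖ ^ (1 / 32 : ℝ) * m ^ (-s.re - 1 / 32)))
    (fun x hx => by
      have h1 : HasDerivAt (fun y : ℝ => ((y - m : ℝ) : ℂ)) 1 x := by
        simpa using ((hasDerivAt_id x).sub_const m).ofReal_comp
      exact (((h1.mul_const _).const_mul _).add
        (hasDerivAt_ofReal_cpow_const_pos (hm0.trans_le hx.1) (1 - s))).hasDerivWithinAt)
    (fun x hx => by
      have : (s - 1) * (1 * (m : ℂ) ^ (-s)) + (1 - s) * (x : ℂ) ^ (1 - s - 1)
          = (s - 1) * ((m : ℂ) ^ (-s) - (x : ℂ) ^ (-s)) := by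
        rw [show 1 - s - 1 = -s by ring]; ring
      rw [this, norm_mul]
      gcongr
      exact norm_cpow_sub_cpow_le_interp hs0 hm0 ⟨hx.1, hx.2.le⟩ (by norm_num) (by norm_num))
    (m + 1) ⟨by linarith, le_rfl⟩
  have e : zetaRegTerm n s = (s - 1) * (((m + 1 - m : ℝ) : ℂ) * (m : ℂ) ^ (-s))
      + ((m + 1 : ℝ) : ℂ) ^ (1 - s)
      - ((s - 1) * (((m - m : ℝ) : ℂ) * (m : ℂ) ^ (-s)) + (m : ℂ) ^ (1 - s)) := by
    have : (n + 2 : ℝ) = m + 1 := by rw [hm]; ring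
    rw [zetaRegTerm, this, ← hm]
    simp
  rw [e]
  refine h.trans ?_
  have : m ^ (-s.re - 1 / 32) ≤ m ^ (-(65 / 64) : ℝ) :=
    Real.rpow_le_rpow_of_exponent_le hm1 (by linarith)
  calc _ = 2 * ‖s - 1‖ * ‖s‖ ^ (1 / 32 : ℝ) * m ^ (-s.re - 1 / 32) := by ring
    _ ≤ _ := by gcongr

lemma summable_nat_add_one_rpow :
    Summable fun n : ℕ => (n + 1 : ℝ) ^ (-(65 / 64) : ℝ) := by
  have h := (summable_nat_add_iff 1).2
    (Real.summable_nat_rpow (p := (-(65 / 64) : ℝ)).2 (by norm_num))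
  simpa using h

lemma summable_zetaRegTerm {s : ℂ} (hs : 1 - 1 / 64 ≤ s.re) :
    Summable fun n => zetaRegTerm n s :=
  Summable.of_norm_bounded (summable_nat_add_one_rpow.mul_left _) (norm_zetaRegTerm_le hs)

lemma exists_norm_zetaReg_sub_one_le : ∃ C : ℝ, 0 < C ∧ ∀ s : ℂ, 1 - 1 / 64 ≤ s.re →
    ‖zetaReg s - 1‖ ≤ C * ‖s - 1‖ * ‖s‖ ^ (1 / 32 : ℝ) := by
  refine ⟨2 * ∑' n : ℕ, (n + 1 : ℝ) ^ (-(65 / 64) : ℝ), ?_, fun s hs => ?_⟩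
  · have := summable_nat_add_one_rpow.tsum_pos (fun n => by positivity) 0 (by positivity)
    positivity
  · have := tsum_of_norm_bounded (summable_nat_add_one_rpow.mul_left
      (2 * ‖s - 1‖ * ‖s‖ ^ (1 / 32 : ℝ))).hasSum (norm_zetaRegTerm_le hs)
    rw [tsum_mul_left] at this
    simp only [zetaReg, add_sub_cancel_left]
    linarith

lemma differentiable_zetaRegTerm (n : ℕ) : Differentiable ℂ (zetaRegTerm n) := by
  have h1 : (((n + 1 : ℝ)) : ℂ) ≠ 0 := by
    rw [Complex.ofReal_ne_zero]; positivity
  have h2 : (((n + 2 : ℝ)) : ℂ) ≠ 0 := by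
    rw [Complex.ofReal_ne_zero]; positivity
  intro s
  unfold zetaRegTerm
  refine ((DifferentiableAt.mul (by fun_prop) ?_).add ?_).sub ?_
  · exact DifferentiableAt.const_cpow (by fun_prop) (Or.inl h1)
  · exact DifferentiableAt.const_cpow (by fun_prop) (Or.inl h2)
  · exact DifferentiableAt.const_cpow (by fun_prop) (Or.inl h1)

lemma differentiableAt_zetaReg {s : ℂ} (hs : 1 - 1 / 64 < s.re) :
    DifferentiableAt ℂ zetaReg s := by
  set R := ‖s‖ + 1
  have ho : IsOpen ({z : ℂ | 1 - 1 / 64 < z.re} ∩ Metric.ball 0 R) :=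
    (isOpen_lt continuous_const Complex.continuous_re).inter Metric.isOpen_ball
  have h := Complex.differentiableOn_tsum_of_summable_norm
    (summable_nat_add_one_rpow.mul_left (2 * (R + 1) * R ^ (1 / 32 : ℝ)))
    (fun n => (differentiable_zetaRegTerm n).differentiableOn) ho
    (fun n z hz => by
      refine (norm_zetaRegTerm_le hz.1.le n).trans ?_
      have hz2 : ‖z‖ ≤ R := (mem_ball_zero_iff.1 hz.2).le
      have : ‖z - 1‖ ≤ R + 1 := (norm_sub_le _ _).trans (by simpa using hz2)
      gcongr)
  exact ((h.differentiableAt (ho.mem_nhds ⟨hs, by simp [R]⟩)).const_add 1)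

lemma zetaReg_eq {s : ℂ} (hs : 1 < s.re) : zetaReg s = (s - 1) * riemannZeta s := by
  have h1 := (summable_zetaRegTerm (s := s) (by linarith)).hasSum.tendsto_sum_nat
  have hsum : Summable fun n : ℕ => 1 / ((n : ℂ) + 1) ^ s := by
    have := (summable_nat_add_iff 1).2 (Complex.summable_one_div_nat_cpow.2 hs)
    simpa using this
  have h2 := hsum.hasSum.tendsto_sum_nat
  rw [← zeta_eq_tsum_one_div_nat_add_one_cpow hs] at h2
  have h3 : Tendsto (fun N : ℕ => ((N + 1 : ℝ) : ℂ) ^ (1 - s)) atTop (nhds 0) := by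
    rw [tendsto_zero_iff_norm_tendsto_zero]
    have e : ∀ N : ℕ, ‖((N + 1 : ℝ) : ℂ) ^ (1 - s)‖ = (N + 1 : ℝ) ^ (-(s.re - 1)) := by
      intro N
      rw [Complex.norm_cpow_eq_rpow_re_of_pos (by positivity)]
      simp
    simp_rw [e]
    exact (tendsto_rpow_neg_atTop (by linarith)).comp
      (tendsto_atTop_add_const_right _ _ tendsto_natCast_atTop_atTop)
  have h4 : ∀ N : ℕ, ∑ n ∈ Finset.range N, zetaRegTerm n s =
      (s - 1) * ∑ n ∈ Finset.range N, 1 / ((n : ℂ) + 1) ^ s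
        + ((N + 1 : ℝ) : ℂ) ^ (1 - s) - 1 := by
    intro N
    induction N with
    | zero => simp
    | succ N ih =>
      rw [Finset.sum_range_succ, ih, Finset.sum_range_succ, zetaRegTerm, Complex.cpow_neg]
      push_cast
      rw [show (N : ℂ) + 1 + 1 = N + 2 by ring]
      ring
  simp_rw [h4] at h1
  have h5 := ((h2.const_mul (s - 1)).add h3).sub_const 1
  rw [zetaReg, tendsto_nhds_unique h1 h5]
  ring

/-- The analytic continuation of `ζ(s) - 1 / (s - 1)` to `1 - 1/64 < re s`. -/
noncomputable def zetaRem : ℂ → ℂ := dslope zetaReg 1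

lemma isOpen_re_gt (a : ℝ) : IsOpen {s : ℂ | a < s.re} :=
  isOpen_lt continuous_const Complex.continuous_re

lemma one_le_norm_of_one_le_re {s : ℂ} (hs : 1 ≤ s.re) : 1 ≤ ‖s‖ :=
  hs.trans (Complex.re_le_norm s)

lemma zetaReg_one : zetaReg 1 = 1 := by
  obtain ⟨C, -, h⟩ := exists_norm_zetaReg_sub_one_le
  have := h 1 (by norm_num)
  simpa [sub_eq_zero] using this

lemma differentiableOn_zetaReg : DifferentiableOn ℂ zetaReg {s | 1 - 1 / 64 < s.re} :=
  fun _ hs => (differentiableAt_zetaReg hs).differentiableWithinAt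

lemma differentiableOn_zetaRem : DifferentiableOn ℂ zetaRem {s | 1 - 1 / 64 < s.re} :=
  (Complex.differentiableOn_dslope ((isOpen_re_gt _).mem_nhds (by norm_num))).2
    differentiableOn_zetaReg

lemma zetaRem_eq {s : ℂ} (hs : s ≠ 1) : zetaRem s = (zetaReg s - 1) / (s - 1) := by
  rw [zetaRem, dslope_of_ne _ hs, slope_def_field, zetaReg_one]

lemma riemannZeta_eq_add_zetaRem {s : ℂ} (hs : 1 < s.re) :
    riemannZeta s = 1 / (s - 1) + zetaRem s := by
  have h1 : s ≠ 1 := by rintro rfl; simp at hs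
  have h2 : s - 1 ≠ 0 := sub_ne_zero.2 h1
  rw [zetaRem_eq h1, zetaReg_eq hs]
  field_simp
  ring

lemma exists_norm_zetaRem_le : ∃ C : ℝ, 0 < C ∧ ∀ s : ℂ, 1 - 1 / 64 < s.re →
    ‖zetaRem s‖ ≤ C * ‖s‖ ^ (1 / 32 : ℝ) := by
  obtain ⟨C, hC, h⟩ := exists_norm_zetaReg_sub_one_le
  refine ⟨max C ‖zetaRem 1‖, lt_max_of_lt_left hC, fun s hs => ?_⟩
  by_cases h1 : s = 1
  · simp [h1]
  · have h2 : 0 < ‖s - 1‖ := norm_pos_iff.2 (sub_ne_zero.2 h1)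
    rw [zetaRem_eq h1, norm_div, div_le_iff₀ h2]
    calc _ ≤ C * ‖s - 1‖ * ‖s‖ ^ (1 / 32 : ℝ) := h s hs.le
      _ = C * ‖s‖ ^ (1 / 32 : ℝ) * ‖s - 1‖ := by ring
      _ ≤ _ := by gcongr; exact le_max_left _ _

lemma exists_norm_zetaReg_le : ∃ C : ℝ, 0 < C ∧ ∀ s : ℂ, 1 - 1 / 64 < s.re →
    ‖zetaReg s‖ ≤ C * ‖s‖ ^ (33 / 32 : ℝ) := by
  obtain ⟨C, hC, h⟩ := exists_norm_zetaReg_sub_one_le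
  refine ⟨4 * (1 + C), by positivity, fun s hs => ?_⟩
  have h0 : 1 / 2 ≤ ‖s‖ := le_trans (by linarith) (Complex.re_le_norm s)
  have h1 : ‖s - 1‖ ≤ 3 * ‖s‖ := by
    refine (norm_sub_le _ _).trans ?_
    rw [norm_one]; linarith
  have h2 : ‖zetaReg s‖ ≤ 1 + ‖zetaReg s - 1‖ := by
    have := norm_add_le (1 : ℂ) (zetaReg s - 1)
    simpa using this
  have h3 : ‖s‖ ^ (33 / 32 : ℝ) = ‖s‖ * ‖s‖ ^ (1 / 32 : ℝ) := by
    rw [show (33 / 32 : ℝ) = 1 + 1 / 32 by norm_num, Real.rpow_add (by linarith), Real.rpow_one]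
  have h4 : (1 / 2 : ℝ) ≤ ‖s‖ ^ (1 / 32 : ℝ) := by
    calc (1 / 2 : ℝ) = (1 / 2 : ℝ) ^ (1 : ℝ) := by simp
      _ ≤ (1 / 2 : ℝ) ^ (1 / 32 : ℝ) :=
        Real.rpow_le_rpow_of_exponent_ge (by norm_num) (by norm_num) (by norm_num)
      _ ≤ _ := by gcongr
  have h5 := h s hs.le
  rw [h3]
  have h6 : C * ‖s - 1‖ * ‖s‖ ^ (1 / 32 : ℝ) ≤ C * (3 * ‖s‖) * ‖s‖ ^ (1 / 32 : ℝ) := by gcongr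
  have h7 : 1 / 4 ≤ ‖s‖ * ‖s‖ ^ (1 / 32 : ℝ) := by nlinarith
  nlinarith

/-- Cauchy's estimate for a function of polynomial growth in a half-plane. -/
lemma exists_norm_iteratedDeriv_le {f : ℂ → ℂ} {a C : ℝ} (ha : 0 ≤ a) (hC : 0 < C)
    (hf : DifferentiableOn ℂ f {s | 1 - 1 / 64 < s.re})
    (hb : ∀ s : ℂ, 1 - 1 / 64 < s.re → ‖f s‖ ≤ C * ‖s‖ ^ a) (j : ℕ) :
    ∃ C' : ℝ, 0 < C' ∧ ∀ s : ℂ, 1 < s.re → ‖iteratedDeriv j f s‖ ≤ C' * ‖s‖ ^ a := by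
  refine ⟨j.factorial * (C * 2 ^ a) / (1 / 100) ^ j, by positivity, fun s hs => ?_⟩
  have hre : ∀ z ∈ Metric.closedBall s (1 / 100), 1 - 1 / 64 < z.re := by
    intro z hz
    have h1 := (Complex.abs_re_le_norm (z - s)).trans (by simpa [dist_eq_norm] using hz)
    rw [Complex.sub_re, abs_le] at h1
    norm_num at h1 ⊢
    linarith [h1.1]
  have h1 := one_le_norm_of_one_le_re hs.le
  have hd : DiffContOnCl ℂ f (Metric.ball s (1 / 100)) := by
    refine DifferentiableOn.diffContOnCl (hf.mono ?_)
    rw [closure_ball _ (by norm_num)]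
    exact hre
  refine (Complex.norm_iteratedDeriv_le_of_forall_mem_sphere_norm_le j (by norm_num) hd
    (C := C * (2 * ‖s‖) ^ a) (fun z hz => ?_)).trans_eq ?_
  · have hz' := Metric.sphere_subset_closedBall hz
    refine (hb z (hre z hz')).trans ?_
    have : ‖z‖ ≤ 2 * ‖s‖ := by
      have h2 : ‖z - s‖ ≤ 1 / 100 := by simpa [dist_eq_norm] using hz'
      have h3 := norm_add_le (z - s) s
      rw [sub_add_cancel] at h3
      linarith
    gcongr
  · rw [Real.mul_rpow (by norm_num) (norm_nonneg _)]
    ring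

lemma exists_norm_iteratedDeriv_zetaRem_le (j : ℕ) : ∃ C : ℝ, 0 < C ∧ ∀ s : ℂ, 1 < s.re →
    ‖iteratedDeriv j zetaRem s‖ ≤ C * ‖s‖ ^ (1 / 32 : ℝ) := by
  obtain ⟨C, hC, h⟩ := exists_norm_zetaRem_le
  exact exists_norm_iteratedDeriv_le (by norm_num) hC differentiableOn_zetaRem h j

lemma exists_norm_iteratedDeriv_zetaReg_le (j : ℕ) : ∃ C : ℝ, 0 < C ∧ ∀ s : ℂ, 1 < s.re →
    ‖iteratedDeriv j zetaReg s‖ ≤ C * ‖s‖ ^ (33 / 32 : ℝ) := by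
  obtain ⟨C, hC, h⟩ := exists_norm_zetaReg_le
  exact exists_norm_iteratedDeriv_le (by norm_num) hC differentiableOn_zetaReg h j

lemma norm_riemannZeta_product_ge_one {x : ℝ} (hx : 0 < x) (t : ℝ) :
    1 ≤ ‖riemannZeta (1 + x)‖ ^ 3 * ‖riemannZeta (1 + x + Complex.I * t)‖ ^ 4 *
      ‖riemannZeta (1 + x + 2 * Complex.I * t)‖ := by
  have h := DirichletCharacter.norm_LFunction_product_ge_one (1 : DirichletCharacter ℂ 1) hx t
  rw [one_pow, DirichletCharacter.LFunctionTrivChar,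
    DirichletCharacter.LFunction_modOne_eq] at h
  simpa using h

lemma norm_le_three_mul_abs_im {s : ℂ} (h1 : 1 < s.re) (h2 : s.re ≤ 2) (ht : 1 ≤ |s.im|) :
    ‖s‖ ≤ 3 * |s.im| := by
  refine (Complex.norm_le_abs_re_add_abs_im s).trans ?_
  rw [abs_of_pos (by linarith)]; linarith

lemma one_le_norm_sub_one {s : ℂ} (ht : 1 ≤ |s.im|) : 1 ≤ ‖s - 1‖ := by
  have := Complex.abs_im_le_norm (s - 1)
  simp only [Complex.sub_im, Complex.one_im, sub_zero] at this
  linarith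

lemma mul_norm_rpow_le_abs_im {s : ℂ} (h1 : 1 < s.re) (h2 : s.re ≤ 2) (ht : 1 ≤ |s.im|)
    {C : ℝ} (hC : 0 < C) :
    1 + C * ‖s‖ ^ (1 / 32 : ℝ) ≤ (1 + 3 * C) * |s.im| ^ (1 / 32 : ℝ) := by
  have h4 : (1 : ℝ) ≤ |s.im| ^ (1 / 32 : ℝ) := Real.one_le_rpow ht (by norm_num)
  have h5 : ‖s‖ ^ (1 / 32 : ℝ) ≤ 3 * |s.im| ^ (1 / 32 : ℝ) := by
    calc ‖s‖ ^ (1 / 32 : ℝ) ≤ (3 * |s.im|) ^ (1 / 32 : ℝ) := by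
          gcongr
          exact norm_le_three_mul_abs_im h1 h2 ht
      _ = 3 ^ (1 / 32 : ℝ) * |s.im| ^ (1 / 32 : ℝ) := Real.mul_rpow (by norm_num) (by positivity)
      _ ≤ 3 ^ (1 : ℝ) * |s.im| ^ (1 / 32 : ℝ) := by
          gcongr
          · norm_num
          · norm_num
      _ = _ := by simp
  nlinarith

lemma exists_norm_riemannZeta_le : ∃ B : ℝ, 1 ≤ B ∧ ∀ s : ℂ, 1 < s.re → s.re ≤ 2 → 1 ≤ |s.im| →
    ‖riemannZeta s‖ ≤ B * |s.im| ^ (1 / 32 : ℝ) := by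
  obtain ⟨C, hC, h⟩ := exists_norm_zetaRem_le
  refine ⟨1 + 3 * C, by linarith, fun s h1 h2 ht => ?_⟩
  refine le_trans ?_ (mul_norm_rpow_le_abs_im h1 h2 ht hC)
  rw [riemannZeta_eq_add_zetaRem h1]
  refine (norm_add_le _ _).trans (add_le_add ?_ (h s (by linarith)))
  rw [norm_div, norm_one]
  exact div_le_one_of_le₀ (one_le_norm_sub_one ht) (norm_nonneg _)

lemma exists_norm_riemannZeta_real_le : ∃ A : ℝ, 1 ≤ A ∧ ∀ x : ℝ, 0 < x → x ≤ 1 →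
    ‖riemannZeta (1 + x)‖ ≤ A / x := by
  obtain ⟨C, hC, h⟩ := exists_norm_zetaRem_le
  refine ⟨1 + 2 * C, by linarith, fun x h0 h1 => ?_⟩
  have hre : (1 + x : ℂ).re = 1 + x := by simp
  rw [riemannZeta_eq_add_zetaRem (by rw [hre]; linarith)]
  refine (norm_add_le _ _).trans ?_
  have e : (1 + 2 * C) / x = 1 / x + 2 * C / x := by ring
  rw [e]
  refine add_le_add (le_of_eq ?_) ?_
  · simp [abs_of_pos h0]
  · refine (h _ (by rw [hre]; linarith)).trans ?_
    have hn : ‖(1 + x : ℂ)‖ ≤ 2 := by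
      refine (norm_add_le _ _).trans ?_
      simp only [norm_one, Complex.norm_real, Real.norm_eq_abs, abs_of_pos h0]
      linarith
    have h2 : ‖(1 + x : ℂ)‖ ^ (1 / 32 : ℝ) ≤ 2 := by
      calc _ ≤ (2 : ℝ) ^ (1 / 32 : ℝ) := by gcongr
        _ ≤ (2 : ℝ) ^ (1 : ℝ) := Real.rpow_le_rpow_of_exponent_le (by norm_num) (by norm_num)
        _ = 2 := by simp
    have h3 : 2 * C ≤ 2 * C / x := by
      rw [le_div_iff₀ h0]; nlinarith
    nlinarith

lemma hasDerivAt_riemannZeta {s : ℂ} (hs : 1 < s.re) :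
    HasDerivAt riemannZeta (-1 / (s - 1) ^ 2 + deriv zetaRem s) s := by
  have h1 : s - 1 ≠ 0 := by
    rw [sub_ne_zero]; rintro rfl; simp at hs
  have hd : HasDerivAt (fun z : ℂ => 1 / (z - 1) + zetaRem z)
      (-1 / (s - 1) ^ 2 + deriv zetaRem s) s := by
    refine HasDerivAt.add ?_ ?_
    · simp only [one_div]
      exact ((hasDerivAt_id s).sub_const 1).inv h1
    · exact (differentiableOn_zetaRem.differentiableAt
        ((isOpen_re_gt _).mem_nhds (by simp only [mem_ofPred_eq]; linarith))).hasDerivAt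
  refine hd.congr_of_eventuallyEq ?_
  filter_upwards [(isOpen_re_gt 1).mem_nhds hs] with z hz
  exact riemannZeta_eq_add_zetaRem hz

lemma exists_norm_deriv_riemannZeta_le : ∃ B : ℝ, 1 ≤ B ∧ ∀ s : ℂ, 1 < s.re → s.re ≤ 2 →
    1 ≤ |s.im| → ‖-1 / (s - 1) ^ 2 + deriv zetaRem s‖ ≤ B * |s.im| ^ (1 / 32 : ℝ) := by
  obtain ⟨C, hC, h⟩ := exists_norm_iteratedDeriv_zetaRem_le 1
  refine ⟨1 + 3 * C, by linarith, fun s h1 h2 ht => ?_⟩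
  refine le_trans ?_ (mul_norm_rpow_le_abs_im h1 h2 ht hC)
  have h3 := h s h1
  rw [iteratedDeriv_one] at h3
  refine (norm_add_le _ _).trans (add_le_add ?_ h3)
  rw [norm_div, norm_neg, norm_one, norm_pow]
  exact div_le_one_of_le₀ (one_le_pow₀ (one_le_norm_sub_one ht)) (by positivity)

lemma exists_le_norm_riemannZeta_of_one_le_abs_im : ∃ c : ℝ, 0 < c ∧ ∀ s : ℂ, 1 < s.re →
    s.re ≤ 2 → 1 ≤ |s.im| → c * |s.im| ^ (-(1 / 8) : ℝ) ≤ ‖riemannZeta s‖ := by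
  obtain ⟨A, hA, hA'⟩ := exists_norm_riemannZeta_real_le
  obtain ⟨B, hB, hB'⟩ := exists_norm_riemannZeta_le
  obtain ⟨D, hD, hD'⟩ := exists_norm_deriv_riemannZeta_le
  set K : ℝ := A ^ 3 * (2 * B) with hK
  have hA3 : 1 ≤ A ^ 3 := one_le_pow₀ hA
  have hK1 : 1 ≤ K := by nlinarith
  have hD4 : 1 ≤ D ^ 4 := one_le_pow₀ hD
  set κ : ℝ := 1 / (16 * D ^ 4 * K) with hκ
  have hκ0 : 0 < κ := by positivity
  have hκ1 : κ ≤ 1 := by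
    rw [hκ]; exact div_le_one_of_le₀ (by nlinarith) (by positivity)
  have hκK : κ * (16 * D ^ 4 * K) = 1 := by rw [hκ]; field_simp
  -- the bound away from the line `re s = 1`
  have key : ∀ (t : ℝ), 1 ≤ |t| → ∀ x : ℝ, κ / (|t| ^ (1 / 32 : ℝ)) ^ 5 ≤ x → x ≤ 1 →
      2 * κ * D / (|t| ^ (1 / 32 : ℝ)) ^ 4 ≤ ‖riemannZeta (1 + x + Complex.I * t)‖ := by
    intro t ht x hx hx1
    set w := |t| ^ (1 / 32 : ℝ) with hw
    have hw1 : 1 ≤ w := Real.one_le_rpow ht (by norm_num)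
    have hx0 : 0 < x := lt_of_lt_of_le (by positivity) hx
    have h1 := norm_riemannZeta_product_ge_one hx0 t
    have h2 := hA' x hx0 hx1
    have h3 := hB' (1 + x + 2 * Complex.I * t) (by simp [hx0]) (by simp; linarith)
      (by simp [abs_mul]; linarith)
    have h3' : ‖riemannZeta (1 + x + 2 * Complex.I * t)‖ ≤ B * (2 * w) := by
      refine h3.trans ?_
      have e : |(1 + x + 2 * Complex.I * t : ℂ).im| = 2 * |t| := by simp [abs_mul]
      rw [e, Real.mul_rpow (by norm_num) (abs_nonneg _)]
      have : (2 : ℝ) ^ (1 / 32 : ℝ) ≤ 2 := by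
        calc _ ≤ (2 : ℝ) ^ (1 : ℝ) := Real.rpow_le_rpow_of_exponent_le (by norm_num) (by norm_num)
          _ = 2 := by simp
      gcongr
    set z := ‖riemannZeta (1 + x + Complex.I * t)‖ with hz
    have hz0 : 0 ≤ z := norm_nonneg _
    have h4 : 1 ≤ (A / x) ^ 3 * z ^ 4 * (B * (2 * w)) := h1.trans (by gcongr)
    have h5 : x ^ 3 ≤ K * w * z ^ 4 := by
      have e : (A / x) ^ 3 * z ^ 4 * (B * (2 * w)) = (K * w * z ^ 4) / x ^ 3 := by
        rw [hK]; field_simp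
      rw [e, le_div_iff₀ (by positivity)] at h4
      linarith
    have h6 : (κ / w ^ 5) ^ 3 ≤ K * w * z ^ 4 := le_trans (by gcongr) h5
    have h7 : (2 * κ * D / w ^ 4) ^ 4 ≤ z ^ 4 := by
      have e : (2 * κ * D / w ^ 4) ^ 4 * (K * w) = (κ / w ^ 5) ^ 3 := by
        have : (2 * κ * D / w ^ 4) ^ 4 * (K * w) =
            (κ * (16 * D ^ 4 * K)) * κ ^ 3 / w ^ 15 := by field_simp; ring
        rw [this, hκK]; field_simp
      rw [← e] at h6
      have h8 : 0 < K * w := by positivity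
      refine le_of_mul_le_mul_right (h6.trans_eq ?_) h8
      ring
    exact le_of_pow_le_pow_left₀ (by norm_num) hz0 h7
  refine ⟨κ * D, by positivity, fun s h1 h2 ht => ?_⟩
  set t := s.im with ht'
  set w := |t| ^ (1 / 32 : ℝ) with hw
  have hw1 : 1 ≤ w := Real.one_le_rpow ht (by norm_num)
  have hw8 : |t| ^ (-(1 / 8) : ℝ) = 1 / w ^ 4 := by
    rw [hw, ← Real.rpow_natCast, ← Real.rpow_mul (abs_nonneg _), Real.rpow_neg (abs_nonneg _),
      one_div]
    norm_num
  rw [hw8, mul_one_div]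
  have hs : s = 1 + ((s.re - 1 : ℝ) : ℂ) + Complex.I * t := by
    apply Complex.ext <;> simp [ht']
  by_cases hcase : κ / w ^ 5 ≤ s.re - 1
  · have := key t ht (s.re - 1) hcase (by linarith)
    rw [← hs] at this
    refine le_trans ?_ this
    gcongr
    nlinarith
  · push Not at hcase
    set d := κ / w ^ 5 with hd
    have hd1 : d ≤ 1 := div_le_one_of_le₀ (hκ1.trans (one_le_pow₀ hw1)) (by positivity)
    have h3 := key t ht d le_rfl hd1
    have hre : ∀ x : ℝ, (1 + (x : ℂ) + Complex.I * t).re = 1 + x := by simp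
    have him : ∀ x : ℝ, (1 + (x : ℂ) + Complex.I * t).im = t := by simp
    have h4 := norm_image_sub_le_of_norm_deriv_le_segment'
      (f := fun x : ℝ => riemannZeta (1 + (x : ℂ) + Complex.I * t))
      (f' := fun x : ℝ => -1 / ((1 + (x : ℂ) + Complex.I * t) - 1) ^ 2
        + deriv zetaRem (1 + (x : ℂ) + Complex.I * t)) (a := s.re - 1) (b := d) (C := D * w)
      (fun x hx => by
        have hb : HasDerivAt (fun z : ℂ => 1 + z + Complex.I * t) 1 (x : ℂ) :=
          ((hasDerivAt_id (x : ℂ)).const_add 1).add_const _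
        have := (hasDerivAt_riemannZeta (s := 1 + (x : ℂ) + Complex.I * t)
          (by rw [hre]; linarith [hx.1])).comp (x : ℂ) hb
        rw [mul_one] at this
        exact this.comp_ofReal.hasDerivWithinAt)
      (fun x hx => by
        have := hD' (1 + (x : ℂ) + Complex.I * t) (by rw [hre]; linarith [hx.1])
          (by rw [hre]; linarith [hx.2]) (by rw [him]; exact ht)
        rwa [him] at this) d ⟨hcase.le, le_rfl⟩
    rw [← hs] at h4
    have h5 := norm_sub_norm_le (riemannZeta (1 + (d : ℂ) + Complex.I * t)) (riemannZeta s)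
    have h6 : D * w * (d - (s.re - 1)) ≤ D * w * d := by gcongr; linarith
    have h7 : D * w * d = κ * D / w ^ 4 := by rw [hd]; field_simp
    have h8 : 2 * κ * D / w ^ 4 = 2 * (κ * D / w ^ 4) := by ring
    linarith

lemma zetaReg_ne_zero {s : ℂ} (hs : 1 ≤ s.re) : zetaReg s ≠ 0 := by
  by_cases h1 : s = 1
  · rw [h1, zetaReg_one]; exact one_ne_zero
  have h : zetaReg s = (s - 1) * riemannZeta s := by
    have ht : Tendsto (fun n : ℕ => s + 1 / ((n : ℂ) + 1)) atTop (nhds s) := by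
      simpa using tendsto_const_nhds.add (tendsto_one_div_add_atTop_nhds_zero_nat (𝕜 := ℂ))
    have c1 := ((differentiableAt_zetaReg (s := s) (by linarith)).continuousAt.tendsto).comp ht
    have c2 : ContinuousAt (fun z => (z - 1) * riemannZeta z) s :=
      ContinuousAt.mul (by fun_prop) (differentiableAt_riemannZeta h1).continuousAt
    have c2 := c2.tendsto.comp ht
    refine tendsto_nhds_unique c1 (c2.congr fun n => ?_)
    refine (zetaReg_eq ?_).symm
    have e : (1 / ((n : ℂ) + 1)) = ((1 / ((n : ℝ) + 1) : ℝ) : ℂ) := by push_cast; rfl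
    rw [Complex.add_re, e, Complex.ofReal_re]
    have : (0 : ℝ) < 1 / ((n : ℝ) + 1) := by positivity
    linarith
  rw [h]
  exact mul_ne_zero (sub_ne_zero.2 h1) (riemannZeta_ne_zero_of_one_le_re hs)

lemma exists_le_norm_zetaReg : ∃ c : ℝ, 0 < c ∧ ∀ s : ℂ, 1 < s.re → s.re ≤ 2 →
    c * ‖s‖ ^ (7 / 8 : ℝ) ≤ ‖zetaReg s‖ := by
  obtain ⟨c, hc, h⟩ := exists_le_norm_riemannZeta_of_one_le_abs_im
  obtain ⟨d, hd, h'⟩ : ∃ d : ℝ, 0 < d ∧ ∀ s ∈ Icc (1 : ℝ) 2 ×ℂ Icc (-1 : ℝ) 1,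
      d ≤ ‖zetaReg s‖ := by
    have hcomp : IsCompact (Icc (1 : ℝ) 2 ×ℂ Icc (-1 : ℝ) 1) := isCompact_Icc.reProdIm isCompact_Icc
    have hre : ∀ s ∈ Icc (1 : ℝ) 2 ×ℂ Icc (-1 : ℝ) 1, 1 ≤ s.re := fun s hs => hs.1.1
    have hcont : ContinuousOn (fun s => ‖zetaReg s‖) (Icc (1 : ℝ) 2 ×ℂ Icc (-1 : ℝ) 1) :=
      fun s hs => (differentiableAt_zetaReg
        (by linarith [hre s hs])).continuousAt.norm.continuousWithinAt
    obtain ⟨z, hz, hmin⟩ := hcomp.exists_isMinOn ⟨1, by constructor <;> simp⟩ hcont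
    exact ⟨‖zetaReg z‖, norm_pos_iff.2 (zetaReg_ne_zero (hre z hz)), fun s hs => hmin hs⟩
  refine ⟨min (c / 9) (d / 3), by positivity, fun s h1 h2 => ?_⟩
  have hs1 := one_le_norm_of_one_le_re h1.le
  by_cases ht : 1 ≤ |s.im|
  · have h3 := h s h1 h2 ht
    rw [zetaReg_eq h1, norm_mul]
    have h4 := norm_le_three_mul_abs_im h1 h2 ht
    have h5 : ‖s‖ ≤ 3 * ‖s - 1‖ := by
      refine h4.trans ?_
      have := Complex.abs_im_le_norm (s - 1)
      simp only [Complex.sub_im, Complex.one_im, sub_zero] at this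
      linarith
    have h6 : ‖s‖ ^ (-(1 / 8) : ℝ) ≤ |s.im| ^ (-(1 / 8) : ℝ) :=
      Real.rpow_le_rpow_of_nonpos (by linarith) (Complex.abs_im_le_norm s) (by norm_num)
    have h7 : ‖s‖ ^ (7 / 8 : ℝ) = ‖s‖ * ‖s‖ ^ (-(1 / 8) : ℝ) := by
      rw [show (7 / 8 : ℝ) = 1 + -(1 / 8) by norm_num, Real.rpow_add (by linarith), Real.rpow_one]
    calc min (c / 9) (d / 3) * ‖s‖ ^ (7 / 8 : ℝ)
        ≤ c / 9 * (3 * ‖s - 1‖ * |s.im| ^ (-(1 / 8) : ℝ)) := by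
          rw [h7]
          gcongr
          exact min_le_left _ _
      _ ≤ ‖s - 1‖ * (c * |s.im| ^ (-(1 / 8) : ℝ)) := by
          have : 0 ≤ ‖s - 1‖ * (c * |s.im| ^ (-(1 / 8) : ℝ)) := by positivity
          nlinarith
      _ ≤ _ := by gcongr
  · push Not at ht
    have h3 := h' s ⟨⟨h1.le, h2⟩, abs_le.1 ht.le⟩
    have h4 : ‖s‖ ≤ 3 := by
      refine (Complex.norm_le_abs_re_add_abs_im s).trans ?_
      rw [abs_of_pos (by linarith)]; linarith
    have h5 : ‖s‖ ^ (7 / 8 : ℝ) ≤ 3 := by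
      calc _ ≤ ‖s‖ ^ (1 : ℝ) := Real.rpow_le_rpow_of_exponent_le hs1 (by norm_num)
        _ ≤ 3 := by simpa using h4
    calc _ ≤ d / 3 * 3 := by
          gcongr
          exact min_le_right _ _
      _ ≤ _ := by linarith

/-- The coefficients of the second derivative of `-ζ'/ζ - ζ`. -/
noncomputable def lambdaLogSq (n : ℕ) : ℝ := (ArithmeticFunction.vonMangoldt n - 1) * log n ^ 2

lemma hasDerivAt_iteratedDeriv {f : ℂ → ℂ} {s : ℂ} (hs : 1 - 1 / 64 < s.re)
    (hf : DifferentiableOn ℂ f {s | 1 - 1 / 64 < s.re}) (j : ℕ) :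
    HasDerivAt (iteratedDeriv j f) (iteratedDeriv (j + 1) f s) s := by
  rw [iteratedDeriv_succ, iteratedDeriv_eq_iterate]
  exact ((hf.analyticAt ((isOpen_re_gt _).mem_nhds hs)).iterated_deriv j).differentiableAt.hasDerivAt

lemma LSeries_vonMangoldt_sub_one {s : ℂ} (hs : 1 < s.re) :
    LSeries ((fun n => (ArithmeticFunction.vonMangoldt n : ℂ)) - 1) s =
      -(deriv zetaReg s / zetaReg s) - zetaRem s := by
  have h1 : s - 1 ≠ 0 := by rw [sub_ne_zero]; rintro rfl; simp at hs
  have hz : riemannZeta s ≠ 0 := riemannZeta_ne_zero_of_one_le_re hs.le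
  rw [LSeries_sub (ArithmeticFunction.LSeriesSummable_vonMangoldt hs)
    (LSeriesSummable_one_iff.2 hs),
    ArithmeticFunction.LSeries_vonMangoldt_eq_deriv_riemannZeta_div hs,
    LSeries_one_eq_riemannZeta hs]
  have hd : deriv zetaReg s = riemannZeta s + (s - 1) * deriv riemannZeta s := by
    have e : zetaReg =ᶠ[nhds s] fun z => (z - 1) * riemannZeta z := by
      filter_upwards [(isOpen_re_gt 1).mem_nhds hs] with z hz
      exact zetaReg_eq hz
    rw [e.deriv_eq]
    have := ((hasDerivAt_id s).sub_const 1).mul (hasDerivAt_riemannZeta hs)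
    rw [(hasDerivAt_riemannZeta hs).deriv]
    rw [one_mul] at this
    exact this.deriv
  have hr : zetaRem s = riemannZeta s - 1 / (s - 1) := by
    rw [riemannZeta_eq_add_zetaRem hs]; ring
  rw [hd, hr, zetaReg_eq hs]
  field_simp
  ring

lemma abscissaOfAbsConv_vonMangoldt_sub_one_le :
    LSeries.abscissaOfAbsConv ((fun n => (ArithmeticFunction.vonMangoldt n : ℂ)) - 1) ≤ 1 := by
  refine LSeries.abscissaOfAbsConv_le_of_forall_lt_LSeriesSummable fun y hy => ?_
  have hy' : 1 < (y : ℂ).re := by simpa using hy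
  exact (ArithmeticFunction.LSeriesSummable_vonMangoldt hy').sub (LSeriesSummable_one_iff.2 hy')

lemma logMul_logMul_vonMangoldt_sub_one :
    LSeries.logMul^[2] ((fun n => (ArithmeticFunction.vonMangoldt n : ℂ)) - 1) =
      fun n => (lambdaLogSq n : ℂ) := by
  funext n
  simp only [Function.iterate_succ, Function.iterate_zero, Function.comp_apply, id_eq,
    LSeries.logMul, lambdaLogSq, Pi.sub_apply, Pi.one_apply]
  push_cast
  rw [← Complex.natCast_log]
  ring

lemma LSeriesSummable_lambdaLogSq {s : ℂ} (hs : 1 < s.re) :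
    LSeriesSummable (fun n => (lambdaLogSq n : ℂ)) s := by
  rw [← logMul_logMul_vonMangoldt_sub_one]
  refine LSeriesSummable_of_abscissaOfAbsConv_lt_re ?_
  rw [LSeries.absicssaOfAbsConv_logPowMul]
  exact abscissaOfAbsConv_vonMangoldt_sub_one_le.trans_lt (by exact_mod_cast hs)

lemma LSeries_lambdaLogSq {s : ℂ} (hs : 1 < s.re) :
    LSeries (fun n => (lambdaLogSq n : ℂ)) s =
      -(iteratedDeriv 3 zetaReg s / zetaReg s
        - 3 * (iteratedDeriv 1 zetaReg s / zetaReg s) * (iteratedDeriv 2 zetaReg s / zetaReg s)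
        + 2 * (iteratedDeriv 1 zetaReg s / zetaReg s) ^ 3) - iteratedDeriv 2 zetaRem s := by
  have h := LSeries_iteratedDeriv (f := (fun n => (ArithmeticFunction.vonMangoldt n : ℂ)) - 1) 2
    (s := s) (abscissaOfAbsConv_vonMangoldt_sub_one_le.trans_lt (by exact_mod_cast hs))
  rw [logMul_logMul_vonMangoldt_sub_one, neg_one_sq, one_mul] at h
  rw [← h]
  have e1 : LSeries ((fun n => (ArithmeticFunction.vonMangoldt n : ℂ)) - 1) =ᶠ[nhds s]
      fun z => -(iteratedDeriv 1 zetaReg z / iteratedDeriv 0 zetaReg z)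
        - iteratedDeriv 0 zetaRem z := by
    filter_upwards [(isOpen_re_gt 1).mem_nhds hs] with z hz
    simp only [iteratedDeriv_one, iteratedDeriv_zero]
    exact LSeries_vonMangoldt_sub_one hz
  have e2 : deriv (fun z => -(iteratedDeriv 1 zetaReg z / iteratedDeriv 0 zetaReg z)
        - iteratedDeriv 0 zetaRem z) =ᶠ[nhds s]
      fun z => -((iteratedDeriv 2 zetaReg z * iteratedDeriv 0 zetaReg z
        - iteratedDeriv 1 zetaReg z * iteratedDeriv 1 zetaReg z) / iteratedDeriv 0 zetaReg z ^ 2)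
        - iteratedDeriv 1 zetaRem z := by
    filter_upwards [(isOpen_re_gt 1).mem_nhds hs] with z hz
    have hz' : 1 - 1 / 64 < z.re := by
      have : 1 < z.re := hz
      linarith
    have h0 : iteratedDeriv 0 zetaReg z ≠ 0 := by
      rw [iteratedDeriv_zero]; exact zetaReg_ne_zero (le_of_lt hz)
    exact ((((hasDerivAt_iteratedDeriv hz' differentiableOn_zetaReg 1).div
      (hasDerivAt_iteratedDeriv hz' differentiableOn_zetaReg 0) h0).neg).sub
      (hasDerivAt_iteratedDeriv hz' differentiableOn_zetaRem 0)).deriv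
  have hs' : 1 - 1 / 64 < s.re := by linarith
  have h0 : iteratedDeriv 0 zetaReg s ≠ 0 := by
    rw [iteratedDeriv_zero]; exact zetaReg_ne_zero hs.le
  rw [iteratedDeriv_succ, iteratedDeriv_one, (e1.deriv.trans e2).deriv_eq]
  have d0 := hasDerivAt_iteratedDeriv hs' differentiableOn_zetaReg 0
  have d1 := hasDerivAt_iteratedDeriv hs' differentiableOn_zetaReg 1
  have d2 := hasDerivAt_iteratedDeriv hs' differentiableOn_zetaReg 2
  have := (((((d2.mul d0).sub (d1.mul d1)).div (d0.pow 2) (pow_ne_zero 2 h0)).neg).sub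
    (hasDerivAt_iteratedDeriv hs' differentiableOn_zetaRem 1)).deriv
  refine this.trans ?_
  rw [iteratedDeriv_zero] at h0
  simp only [Pi.mul_apply, Pi.pow_apply, Pi.sub_apply, iteratedDeriv_zero, zero_add]
  congr 2
  field_simp
  ring

lemma exists_norm_LSeries_lambdaLogSq_le : ∃ C : ℝ, 0 < C ∧ ∀ s : ℂ, 1 < s.re → s.re ≤ 2 →
    ‖LSeries (fun n => (lambdaLogSq n : ℂ)) s‖ ≤ C * ‖s‖ ^ (1 / 2 : ℝ) := by
  obtain ⟨c, hc, h⟩ := exists_le_norm_zetaReg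
  have hq : ∀ j, ∃ C : ℝ, 0 < C ∧ ∀ s : ℂ, 1 < s.re → s.re ≤ 2 →
      ‖iteratedDeriv j zetaReg s / zetaReg s‖ ≤ C * ‖s‖ ^ (5 / 32 : ℝ) := by
    intro j
    obtain ⟨C, hC, h'⟩ := exists_norm_iteratedDeriv_zetaReg_le j
    refine ⟨C / c, by positivity, fun s h1 h2 => ?_⟩
    have hs : 0 < ‖s‖ := lt_of_lt_of_le one_pos (one_le_norm_of_one_le_re h1.le)
    have hp : 0 < ‖zetaReg s‖ := norm_pos_iff.2 (zetaReg_ne_zero h1.le)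
    rw [norm_div, div_le_iff₀ hp]
    calc _ ≤ C * ‖s‖ ^ (33 / 32 : ℝ) := h' s h1
      _ = C / c * ‖s‖ ^ (5 / 32 : ℝ) * (c * ‖s‖ ^ (7 / 8 : ℝ)) := by
        rw [show (33 / 32 : ℝ) = 5 / 32 + 7 / 8 by norm_num, Real.rpow_add hs]
        field_simp
      _ ≤ _ := by
        gcongr
        exact h s h1 h2
  obtain ⟨C1, hC1, h1⟩ := hq 1
  obtain ⟨C2, hC2, h2⟩ := hq 2
  obtain ⟨C3, hC3, h3⟩ := hq 3
  obtain ⟨C4, hC4, h4⟩ := exists_norm_iteratedDeriv_zetaRem_le 2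
  refine ⟨C3 + 3 * C1 * C2 + 2 * C1 ^ 3 + C4, by positivity, fun s hs hs2 => ?_⟩
  have hn := one_le_norm_of_one_le_re hs.le
  specialize h1 s hs hs2
  specialize h2 s hs hs2
  specialize h3 s hs hs2
  specialize h4 s hs
  have hn0 : (0 : ℝ) ≤ ‖s‖ := norm_nonneg _
  have mono : ∀ a : ℝ, a ≤ 1 / 2 → ‖s‖ ^ a ≤ ‖s‖ ^ (1 / 2 : ℝ) := fun a ha =>
    Real.rpow_le_rpow_of_exponent_le hn ha
  have w1 := mono (5 / 32) (by norm_num)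
  have w2 : (‖s‖ ^ (5 / 32 : ℝ)) ^ 2 ≤ ‖s‖ ^ (1 / 2 : ℝ) := by
    rw [← Real.rpow_natCast, ← Real.rpow_mul hn0]; exact mono _ (by norm_num)
  have w3 : (‖s‖ ^ (5 / 32 : ℝ)) ^ 3 ≤ ‖s‖ ^ (1 / 2 : ℝ) := by
    rw [← Real.rpow_natCast, ← Real.rpow_mul hn0]; exact mono _ (by norm_num)
  have w4 := mono (1 / 32) (by norm_num)
  set w := ‖s‖ ^ (5 / 32 : ℝ)
  have hw : 0 ≤ w := by positivity
  rw [LSeries_lambdaLogSq hs]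
  set q1 := iteratedDeriv 1 zetaReg s / zetaReg s
  set q2 := iteratedDeriv 2 zetaReg s / zetaReg s
  set q3 := iteratedDeriv 3 zetaReg s / zetaReg s
  have t1 : ‖3 * q1 * q2‖ ≤ 3 * C1 * C2 * ‖s‖ ^ (1 / 2 : ℝ) := by
    rw [norm_mul, norm_mul, Complex.norm_ofNat]
    calc _ ≤ 3 * (C1 * w) * (C2 * w) := by gcongr
      _ = 3 * C1 * C2 * w ^ 2 := by ring
      _ ≤ _ := by gcongr
  have t2 : ‖2 * q1 ^ 3‖ ≤ 2 * C1 ^ 3 * ‖s‖ ^ (1 / 2 : ℝ) := by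
    rw [norm_mul, norm_pow, Complex.norm_ofNat]
    calc _ ≤ 2 * (C1 * w) ^ 3 := by gcongr
      _ = 2 * C1 ^ 3 * w ^ 3 := by ring
      _ ≤ _ := by gcongr
  have t3 : ‖q3‖ ≤ C3 * ‖s‖ ^ (1 / 2 : ℝ) := h3.trans (by gcongr)
  have t4 : ‖iteratedDeriv 2 zetaRem s‖ ≤ C4 * ‖s‖ ^ (1 / 2 : ℝ) := h4.trans (by gcongr)
  have t5 : ‖-(q3 - 3 * q1 * q2 + 2 * q1 ^ 3) - iteratedDeriv 2 zetaRem s‖ ≤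
      ‖q3‖ + ‖3 * q1 * q2‖ + ‖2 * q1 ^ 3‖ + ‖iteratedDeriv 2 zetaRem s‖ := by
    refine (norm_sub_le _ _).trans ?_
    gcongr
    rw [norm_neg]
    refine (norm_add_le _ _).trans ?_
    gcongr
    exact norm_sub_le _ _
  linarith

lemma hasMellin_max_one_sub {s : ℂ} (hs : 0 < s.re) :
    HasMellin (fun t : ℝ => ((max (1 - t) 0 : ℝ) : ℂ)) s (1 / s - 1 / (s + 1)) := by
  have h1 := hasMellin_one_Ioc hs
  have h2 := hasMellin_cpow_Ioc 1 (s := s) (by simp; linarith)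
  have h := hasMellin_sub h1.1 h2.1
  rw [h1.2, h2.2] at h
  have e : EqOn (fun t : ℝ => indicator (Ioc 0 1) (fun _ => 1 : ℝ → ℂ) t -
      indicator (Ioc 0 1) (fun t => ↑t ^ (1 : ℂ) : ℝ → ℂ) t)
      (fun t : ℝ => ((max (1 - t) 0 : ℝ) : ℂ)) (Ioi 0) := by
    intro t ht
    have ht' : 0 < t := ht
    by_cases h1 : t ≤ 1
    · have : t ∈ Ioc (0 : ℝ) 1 := ⟨ht', h1⟩
      simp [this, max_eq_left (sub_nonneg.2 h1)]
    · have : t ∉ Ioc (0 : ℝ) 1 := fun h => h1 h.2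
      simp [this, max_eq_right (sub_nonpos.2 (le_of_not_ge h1))]
  constructor
  · refine (MeasureTheory.integrableOn_congr_fun ?_ measurableSet_Ioi).1 h.1
    intro t ht
    simp only [e ht]
  · rw [← h.2]
    refine MeasureTheory.setIntegral_congr_fun measurableSet_Ioi ?_
    intro t ht
    simp only [← e ht]

lemma sqrt_one_add_sq_le_norm {c : ℝ} (hc : 1 ≤ c) (t : ℝ) :
    √(1 + t ^ 2) ≤ ‖(c + t * Complex.I : ℂ)‖ := by
  rw [Complex.norm_add_mul_I]
  gcongr
  nlinarith

lemma norm_one_div_sub_one_div_le {c : ℝ} (hc : 1 ≤ c) (t : ℝ) :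
    ‖1 / (c + t * Complex.I : ℂ) - 1 / (c + t * Complex.I + 1)‖ ≤
      (‖(c + t * Complex.I : ℂ)‖ * √(1 + t ^ 2))⁻¹ := by
  have hp : 0 < √(1 + t ^ 2) := by positivity
  have h1 := sqrt_one_add_sq_le_norm hc t
  have h2 := sqrt_one_add_sq_le_norm (c := c + 1) (by linarith) t
  have h3 : (c + t * Complex.I + 1 : ℂ) = ((c + 1 : ℝ) : ℂ) + t * Complex.I := by push_cast; ring
  rw [h3]
  have n1 := norm_pos_iff.1 (hp.trans_le h1)
  have n2 := norm_pos_iff.1 (hp.trans_le h2)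
  rw [div_sub_div _ _ n1 n2, norm_div, norm_mul, ← h3]
  rw [← h3] at h2
  simp only [one_mul, mul_one, add_sub_cancel_left, norm_one, one_div]
  gcongr

lemma integrable_one_div_sub_one_div {c : ℝ} (hc : 1 ≤ c) :
    MeasureTheory.Integrable
      fun t : ℝ => 1 / (c + t * Complex.I : ℂ) - 1 / (c + t * Complex.I + 1) := by
  refine integrable_inv_one_add_sq.mono' ?_ (.of_forall fun t => ?_)
  · refine Continuous.aestronglyMeasurable ?_
    refine .sub (continuous_const.div (by fun_prop) fun t h => ?_)
      (continuous_const.div (by fun_prop) fun t h => ?_)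
    · have := congrArg Complex.re h
      simp at this
      linarith
    · have := congrArg Complex.re h
      simp at this
      linarith
  · refine (norm_one_div_sub_one_div_le hc t).trans ?_
    have h1 := sqrt_one_add_sq_le_norm hc t
    gcongr
    calc (1 + t ^ 2 : ℝ) = √(1 + t ^ 2) * √(1 + t ^ 2) := (mul_self_sqrt (by positivity)).symm
      _ ≤ _ := by gcongr

/-- A smoothed Perron formula. -/
lemma integral_cpow_neg_mul_one_div_sub_one_div {c y : ℝ} (hc : 1 ≤ c) (hy : 0 < y) :
    ∫ t : ℝ, (y : ℂ) ^ (-(c + t * Complex.I)) *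
      (1 / (c + t * Complex.I : ℂ) - 1 / (c + t * Complex.I + 1)) =
      2 * π * (max (1 - y) 0 : ℝ) := by
  have hm : ∀ t : ℝ, HasMellin (fun t : ℝ => ((max (1 - t) 0 : ℝ) : ℂ)) (c + t * Complex.I)
      (1 / (c + t * Complex.I) - 1 / (c + t * Complex.I + 1)) := fun t =>
    hasMellin_max_one_sub (by simp; linarith)
  have h := mellinInv_mellin_eq c (fun t : ℝ => ((max (1 - t) 0 : ℝ) : ℂ)) hy
    (hasMellin_max_one_sub (by simp; linarith)).1 (by
      rw [Complex.VerticalIntegrable]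
      simp only [(hm _).2]
      exact integrable_one_div_sub_one_div hc) (by fun_prop)
  rw [← h, mellinInv]
  simp only [(hm _).2, smul_eq_mul, Complex.real_smul]
  push_cast
  rw [← mul_assoc, mul_one_div_cancel (by simp [pi_ne_zero]), one_mul]

lemma norm_sum_mul_one_sub_div_le {f : ℕ → ℂ} {c x C : ℝ} (hc : 1 ≤ c) (hx : 0 < x)
    (hf : LSeriesSummable f c)
    (hC : ∀ t : ℝ, ‖LSeries f (c + t * Complex.I)‖ ≤
      C * ‖(c + t * Complex.I : ℂ)‖ ^ (1 / 2 : ℝ)) :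
    ‖∑ n ∈ Finset.Ioc 0 ⌊x⌋₊, f n * (1 - n / x)‖ ≤
      C * x ^ c * ∫ t : ℝ, (1 + ‖t‖ ^ 2) ^ (-(3 / 2 : ℝ) / 2) := by
  set K : ℝ → ℂ := fun t => 1 / (c + t * Complex.I : ℂ) - 1 / (c + t * Complex.I + 1) with hK
  have hKi : MeasureTheory.Integrable K := integrable_one_div_sub_one_div hc
  have hC0 : 0 ≤ C := by
    have := (norm_nonneg _).trans (hC 0)
    have hp : 0 < ‖(c + (0 : ℝ) * Complex.I : ℂ)‖ ^ (1 / 2 : ℝ) := by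
      have : 0 < ‖(c + (0 : ℝ) * Complex.I : ℂ)‖ :=
        lt_of_lt_of_le (by positivity) (sqrt_one_add_sq_le_norm hc 0)
      positivity
    exact nonneg_of_mul_nonneg_left this hp
  set F : ℕ → ℝ → ℂ := fun n t =>
    (x : ℂ) ^ (c + t * Complex.I) * LSeries.term f (c + t * Complex.I) n * K t with hF
  have hxc : ∀ t : ℝ, ‖(x : ℂ) ^ (c + t * Complex.I)‖ = x ^ c := fun t => by
    rw [Complex.norm_cpow_eq_rpow_re_of_pos hx]; simp
  have hFn : ∀ n t, ‖F n t‖ = x ^ c * ‖LSeries.term f c n‖ * ‖K t‖ := fun n t => by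
    simp only [hF, norm_mul, hxc, LSeries.norm_term_eq]
    simp
  have hcont : ∀ n, Continuous fun t : ℝ => LSeries.term f (c + t * Complex.I) n := by
    intro n
    rcases eq_or_ne n 0 with rfl | hn
    · simp only [LSeries.term_zero]; exact continuous_const
    · simp only [LSeries.term_of_ne_zero hn]
      have hn' : (n : ℂ) ≠ 0 := by exact_mod_cast hn
      refine continuous_const.div ?_ fun t => by simp [Complex.cpow_eq_zero_iff, hn]
      exact Continuous.const_cpow (by fun_prop) (.inl hn')
  have hxcont : Continuous fun t : ℝ => (x : ℂ) ^ (c + t * Complex.I) :=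
    Continuous.const_cpow (by fun_prop) (.inl (by exact_mod_cast hx.ne'))
  have hFi : ∀ n, MeasureTheory.Integrable (F n) := by
    intro n
    refine (hKi.norm.const_mul (x ^ c * ‖LSeries.term f c n‖)).mono' ?_
      (.of_forall fun t => (hFn n t).le)
    exact (hxcont.mul (hcont n)).aestronglyMeasurable.mul hKi.aestronglyMeasurable
  have hsum : Summable fun n => ∫ t, ‖F n t‖ := by
    simp only [hFn, MeasureTheory.integral_const_mul]
    exact (hf.norm.mul_left _).mul_right _
  have hS := MeasureTheory.hasSum_integral_of_summable_integral_norm hFi hsum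
  have hval : ∀ n : ℕ, ∫ t, F n t =
      if n = 0 then 0 else 2 * π * (f n * (max (1 - n / x) 0 : ℝ)) := by
    intro n
    split_ifs with hn
    · simp [hF, hn, LSeries.term_zero]
    · have hnx : 0 < (n : ℝ) / x := by positivity
      have := integral_cpow_neg_mul_one_div_sub_one_div hc hnx
      calc _ = ∫ t : ℝ, f n * (((n / x : ℝ) : ℂ) ^ (-(c + t * Complex.I)) * K t) := by
            congr 1
            ext t
            simp only [hF, LSeries.term_of_ne_zero hn]
            rw [Complex.cpow_neg]
            push_cast
            have e := Complex.mul_cpow_ofReal_nonneg (a := n / x) (b := x)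
              (by positivity) hx.le (c + t * Complex.I)
            push_cast at e
            have hx' : (x : ℂ) ≠ 0 := by exact_mod_cast hx.ne'
            rw [div_mul_cancel₀ _ hx'] at e
            rw [e]
            have hx2 : (x : ℂ) ^ (c + t * Complex.I) ≠ 0 := by simp [Complex.cpow_eq_zero_iff, hx']
            field_simp
        _ = _ := by
            rw [MeasureTheory.integral_const_mul, this]
            ring
  have hfin : ∑' n, ∫ t, F n t = 2 * π * ∑ n ∈ Finset.Ioc 0 ⌊x⌋₊, f n * (1 - n / x) := by
    rw [tsum_eq_sum (s := Finset.Ioc 0 ⌊x⌋₊), Finset.mul_sum]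
    · refine Finset.sum_congr rfl fun n hn => ?_
      rw [Finset.mem_Ioc] at hn
      have : (n : ℝ) ≤ x := (Nat.le_floor_iff hx.le).1 hn.2
      have h1 : (n : ℝ) / x ≤ 1 := (div_le_one hx).2 this
      rw [hval, if_neg (by lia), max_eq_left (by linarith)]
      push_cast
      rfl
    · intro n hn
      rw [hval]
      split_ifs with h0
      · rfl
      · have : x < n := by
          rw [Finset.mem_Ioc] at hn
          push Not at hn
          exact (Nat.floor_lt hx.le).1 (hn (by lia))
        have h1 : 1 < (n : ℝ) / x := (one_lt_div hx).2 this
        rw [max_eq_right (by linarith)]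
        simp
  have hF_sum := hS.tsum_eq
  rw [hfin] at hF_sum
  have hI : MeasureTheory.Integrable fun t : ℝ => (1 + ‖t‖ ^ 2) ^ (-(3 / 2 : ℝ) / 2) :=
    integrable_rpow_neg_one_add_norm_sq (by simp; norm_num)
  have hb : ‖∫ t, ∑' n, F n t‖ ≤ ∫ t : ℝ, C * x ^ c * (1 + ‖t‖ ^ 2) ^ (-(3 / 2 : ℝ) / 2) := by
    refine MeasureTheory.norm_integral_le_of_norm_le (hI.const_mul _) (.of_forall fun t => ?_)
    have e : ∑' n, F n t = (x : ℂ) ^ (c + t * Complex.I) * LSeries f (c + t * Complex.I) * K t := by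
      simp only [hF]
      rw [tsum_mul_right, tsum_mul_left, LSeries]
    rw [e, norm_mul, norm_mul, hxc]
    have h1 := sqrt_one_add_sq_le_norm hc t
    have hp : 0 < √(1 + t ^ 2) := by positivity
    set w := ‖(c + t * Complex.I : ℂ)‖
    have hw : 0 < w := hp.trans_le h1
    calc _ ≤ x ^ c * (C * w ^ (1 / 2 : ℝ)) * (w * √(1 + t ^ 2))⁻¹ := by
          gcongr
          · exact hC t
          · exact norm_one_div_sub_one_div_le hc t
      _ = C * x ^ c * (w ^ (-(1 / 2) : ℝ) * (√(1 + t ^ 2))⁻¹) := by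
          have : w ^ (1 / 2 : ℝ) = w * w ^ (-(1 / 2) : ℝ) := by
            nth_rw 2 [← Real.rpow_one w]
            rw [← Real.rpow_add hw]; norm_num
          rw [this]
          field_simp
      _ ≤ C * x ^ c * ((√(1 + t ^ 2)) ^ (-(1 / 2) : ℝ) * (√(1 + t ^ 2))⁻¹) := by
          gcongr _ * (?_ * _)
          exact Real.rpow_le_rpow_of_nonpos hp h1 (by norm_num)
      _ = _ := by
          congr 1
          rw [← Real.rpow_neg_one, ← Real.rpow_add hp, Real.sqrt_eq_rpow,
            ← Real.rpow_mul (by positivity), Real.norm_eq_abs, sq_abs]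
          norm_num
  rw [← hF_sum, norm_mul, MeasureTheory.integral_const_mul] at hb
  refine le_trans ?_ hb
  have : (1 : ℝ) ≤ ‖(2 * π : ℂ)‖ := by
    rw [norm_mul, Complex.norm_ofNat, Complex.norm_real, Real.norm_of_nonneg pi_nonneg]
    linarith [pi_gt_three]
  exact le_mul_of_one_le_left (norm_nonneg _) this

lemma exists_abs_sum_lambdaLogSq_mul_sub_le : ∃ C : ℝ, 0 < C ∧ ∀ x : ℝ, 1 ≤ x →
    |∑ n ∈ Finset.Ioc 0 ⌊x⌋₊, lambdaLogSq n * (x - n)| ≤ C * x ^ 2 := by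
  obtain ⟨C, hC, h⟩ := exists_norm_LSeries_lambdaLogSq_le
  set I := ∫ t : ℝ, (1 + ‖t‖ ^ 2) ^ (-(3 / 2 : ℝ) / 2)
  have hI : 0 ≤ I := MeasureTheory.integral_nonneg fun t => by positivity
  refine ⟨C * exp 1 * I + 1, by positivity, fun x hx1 => ?_⟩
  have hx0 : 0 < x := by linarith
  rcases lt_or_ge x 2 with hx | hx
  · have : ⌊x⌋₊ = 1 := by rw [Nat.floor_eq_iff hx0.le]; norm_num; exact ⟨hx1, hx⟩
    rw [this]
    simp [lambdaLogSq]
    positivity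
  have hl : 1 / 2 ≤ log x := by
    have := Real.log_le_log two_pos hx
    linarith [Real.log_two_gt_d9]
  set c := 1 + 1 / (2 * log x) with hc
  have hd : 0 < 1 / (2 * log x) := by positivity
  have hd' : 1 / (2 * log x) ≤ 1 := by
    rw [div_le_one (by positivity)]; linarith
  have hb := norm_sum_mul_one_sub_div_le (f := fun n => (lambdaLogSq n : ℂ)) (c := c) (x := x)
    (C := C) (by linarith) hx0 (LSeriesSummable_lambdaLogSq (by simp only [Complex.ofReal_re]; linarith))
    (fun t => h _ (by simp; linarith) (by simp; linarith))
  have hxc : x ^ c ≤ exp 1 * x := by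
    rw [hc, Real.rpow_add hx0, Real.rpow_one, mul_comm]
    gcongr
    rw [Real.rpow_def_of_pos hx0]
    gcongr
    rw [mul_one_div, div_le_one (by positivity)]
    linarith
  have e : ∑ n ∈ Finset.Ioc 0 ⌊x⌋₊, (lambdaLogSq n : ℂ) * (1 - n / x) =
      ((∑ n ∈ Finset.Ioc 0 ⌊x⌋₊, lambdaLogSq n * (1 - n / x) : ℝ) : ℂ) := by push_cast; rfl
  rw [e, Complex.norm_real, Real.norm_eq_abs] at hb
  have e2 : ∑ n ∈ Finset.Ioc 0 ⌊x⌋₊, lambdaLogSq n * (x - n) =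
      x * ∑ n ∈ Finset.Ioc 0 ⌊x⌋₊, lambdaLogSq n * (1 - n / x) := by
    rw [Finset.mul_sum]
    refine Finset.sum_congr rfl fun n _ => ?_
    field_simp
  rw [e2, abs_mul, abs_of_pos hx0]
  calc _ ≤ x * (C * (exp 1 * x) * I) := by
        gcongr
        refine hb.trans ?_
        gcongr
    _ ≤ _ := by nlinarith [sq_nonneg x]

lemma sum_mul_sub_sub_sum_mul_sub (a : ℕ → ℝ) {u v : ℝ} (huv : u ≤ v) :
    (∑ n ∈ Finset.Ioc 0 ⌊v⌋₊, a n * (v - n)) - ∑ n ∈ Finset.Ioc 0 ⌊u⌋₊, a n * (u - n) =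
      (v - u) * (∑ n ∈ Finset.Ioc 0 ⌊u⌋₊, a n) + ∑ n ∈ Finset.Ioc ⌊u⌋₊ ⌊v⌋₊, a n * (v - n) := by
  have hf := Nat.floor_mono huv
  rw [← Finset.sum_Ioc_consecutive _ (Nat.zero_le _) hf, add_sub_right_comm,
    ← Finset.sum_sub_distrib, Finset.mul_sum]
  congr 1
  exact Finset.sum_congr rfl fun n _ => by ring

lemma neg_mul_le_sum_mul {a w : ℕ → ℝ} {u v L : ℝ} (hu : 0 ≤ u) (huv : u ≤ v) (hL : 0 ≤ L)
    (ha : ∀ n ∈ Finset.Ioc ⌊u⌋₊ ⌊v⌋₊, -L ≤ a n)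
    (hw : ∀ n ∈ Finset.Ioc ⌊u⌋₊ ⌊v⌋₊, 0 ≤ w n ∧ w n ≤ v - u) :
    -((v - u) * (v - u + 1) * L) ≤ ∑ n ∈ Finset.Ioc ⌊u⌋₊ ⌊v⌋₊, a n * w n := by
  have hf := Nat.floor_mono huv
  have h1 : ∑ n ∈ Finset.Ioc ⌊u⌋₊ ⌊v⌋₊, -(L * (v - u)) ≤
      ∑ n ∈ Finset.Ioc ⌊u⌋₊ ⌊v⌋₊, a n * w n := by
    refine Finset.sum_le_sum fun n hn => ?_
    obtain ⟨h1, h2⟩ := hw n hn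
    nlinarith [mul_le_mul_of_nonneg_right (ha n hn) h1, mul_le_mul_of_nonneg_left h2 hL]
  refine le_trans ?_ h1
  rw [Finset.sum_const, Nat.card_Ioc, nsmul_eq_mul, Nat.cast_sub hf]
  have h2 := Nat.floor_le (hu.trans huv)
  have h3 := Nat.lt_floor_add_one u
  have h4 : ((⌊v⌋₊ : ℝ) - ⌊u⌋₊) * (L * (v - u)) ≤ (v - u + 1) * (L * (v - u)) := by
    have : 0 ≤ v - u := by linarith
    gcongr
    linarith
  nlinarith

lemma neg_log_sq_le_lambdaLogSq (n : ℕ) : -log n ^ 2 ≤ lambdaLogSq n := by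
  rw [lambdaLogSq]
  nlinarith [mul_nonneg (ArithmeticFunction.vonMangoldt_nonneg (n := n)) (sq_nonneg (log n))]

lemma exists_abs_sum_lambdaLogSq_le : ∃ C : ℝ, 0 < C ∧ ∀ N : ℕ, 2 ≤ N →
    |∑ n ∈ Finset.Ioc 0 N, lambdaLogSq n| ≤ C * (N * log N) := by
  obtain ⟨C, hC, h⟩ := exists_abs_sum_lambdaLogSq_mul_sub_le
  refine ⟨32 * C + 5, by positivity, fun N hN => ?_⟩
  obtain ⟨x, hx⟩ : ∃ x : ℝ, x = N := ⟨_, rfl⟩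
  rw [← hx]
  have hx2 : 2 ≤ x := by rw [hx]; exact_mod_cast hN
  have hl : 1 / 2 ≤ log x := by
    have := Real.log_le_log two_pos hx2
    linarith [Real.log_two_gt_d9]
  have hlx : log x ≤ x := by linarith [Real.log_le_sub_one_of_pos (x := x) (by linarith)]
  set h' := x / (4 * log x) with hh
  have hh0 : 0 < h' := by positivity
  have hhl : h' * log x = x / 4 := by rw [hh]; field_simp
  have hhx : h' ≤ x / 2 := by nlinarith
  set L := (2 * log x) ^ 2 with hL
  have hlog : ∀ n : ℕ, 0 < n → (n : ℝ) ≤ 2 * x → -L ≤ lambdaLogSq n := by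
    intro n hn hn2
    refine le_trans ?_ (neg_log_sq_le_lambdaLogSq n)
    rw [hL]
    have hn0 : (1 : ℝ) ≤ n := by exact_mod_cast hn
    have h0 := Real.log_nonneg hn0
    have h1 : log n ≤ 2 * log x := by
      calc log n ≤ log (2 * x) := Real.log_le_log (by linarith) hn2
        _ = log 2 + log x := Real.log_mul (by norm_num) (by linarith)
        _ ≤ _ := by linarith [Real.log_le_log two_pos hx2]
    have := pow_le_pow_left₀ h0 h1 2
    linarith
  have hfl : ⌊x⌋₊ = N := by rw [hx, Nat.floor_natCast]
  have memb : ∀ u v : ℝ, 0 ≤ u → u ≤ v → ∀ n ∈ Finset.Ioc ⌊u⌋₊ ⌊v⌋₊, u < n ∧ (n : ℝ) ≤ v ∧ 0 < n := by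
    intro u v hu huv n hn
    rw [Finset.mem_Ioc] at hn
    exact ⟨(Nat.floor_lt hu).1 hn.1, (Nat.le_floor_iff (hu.trans huv)).1 hn.2, by lia⟩
  have hW : ∀ y : ℝ, 1 ≤ y → y ≤ 2 * x →
      |∑ n ∈ Finset.Ioc 0 ⌊y⌋₊, lambdaLogSq n * (y - n)| ≤ 4 * C * x ^ 2 := by
    intro y hy hyx
    refine (h y hy).trans ?_
    have := pow_le_pow_left₀ (by linarith) hyx 2
    nlinarith
  have w0 := abs_le.1 (hW x (by linarith) (by linarith))
  have w1 := abs_le.1 (hW (x + h') (by linarith) (by linarith))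
  have w2 := abs_le.1 (hW (x - h') (by linarith) (by linarith))
  have d1 := sum_mul_sub_sub_sum_mul_sub lambdaLogSq (u := x) (v := x + h') (by linarith)
  have d2 := sum_mul_sub_sub_sum_mul_sub lambdaLogSq (u := x - h') (v := x) (by linarith)
  have l1 := neg_mul_le_sum_mul (a := lambdaLogSq) (w := fun n => x + h' - n) (u := x)
    (v := x + h') (L := L) (by linarith) (by linarith) (by positivity)
    (fun n hn => by
      have := memb _ _ (by linarith) (by linarith) n hn
      exact hlog n this.2.2 (by linarith))
    (fun n hn => by
      have := memb _ _ (by linarith) (by linarith) n hn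
      constructor <;> linarith)
  have l2 := neg_mul_le_sum_mul (a := lambdaLogSq) (w := fun n => n - (x - h')) (u := x - h')
    (v := x) (L := L) (by linarith) (by linarith) (by positivity)
    (fun n hn => by
      have := memb _ _ (by linarith) (by linarith) n hn
      exact hlog n this.2.2 (by linarith))
    (fun n hn => by
      have := memb _ _ (by linarith) (by linarith) n hn
      constructor <;> linarith)
  have e2 : ∑ n ∈ Finset.Ioc ⌊x - h'⌋₊ ⌊x⌋₊, lambdaLogSq n * (n - (x - h')) =
      h' * (∑ n ∈ Finset.Ioc ⌊x - h'⌋₊ ⌊x⌋₊, lambdaLogSq n) -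
        ∑ n ∈ Finset.Ioc ⌊x - h'⌋₊ ⌊x⌋₊, lambdaLogSq n * (x - n) := by
    rw [Finset.mul_sum, ← Finset.sum_sub_distrib]
    exact Finset.sum_congr rfl fun n _ => by ring
  have e3 := Finset.sum_Ioc_consecutive lambdaLogSq (Nat.zero_le _)
    (Nat.floor_mono (show x - h' ≤ x by linarith))
  rw [e2] at l2
  rw [hfl] at d1 d2 l1 l2 e3 w0
  set E := ∑ n ∈ Finset.Ioc 0 N, lambdaLogSq n
  rw [show x + h' - x = h' by ring] at d1 l1
  rw [show x - (x - h') = h' by ring] at d2 l2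
  have key : ∀ B : ℝ, B * h' ≤ 8 * C * x ^ 2 + h' * (h' + 1) * L →
      B ≤ (32 * C + 5) * (x * log x) := by
    intro B hB
    have e : 8 * C * x ^ 2 + h' * (h' + 1) * L =
        (32 * C * (x * log x) + x * log x + 4 * (log x * log x)) * h' := by
      rw [hL]
      linear_combination (-(32 * C * x) + 4 * h' * log x) * hhl
    rw [e] at hB
    have := le_of_mul_le_mul_right hB hh0
    nlinarith
  rw [abs_le]
  constructor
  · suffices -E ≤ (32 * C + 5) * (x * log x) by linarith
    refine key _ ?_
    nlinarith [congrArg (h' * ·) e3]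
  · refine key _ ?_
    linarith

/-- The coefficients `log³ n` on primes, compensated by their average `log² n`. -/
noncomputable def primeLogCubeSub (n : ℕ) : ℝ := (if n.Prime then log n ^ 3 else 0) - log n ^ 2

lemma lambdaLogSq_sub_primeLogCubeSub (n : ℕ) :
    lambdaLogSq n - primeLogCubeSub n =
      if n.Prime then 0 else ArithmeticFunction.vonMangoldt n * log n ^ 2 := by
  rw [lambdaLogSq, primeLogCubeSub]
  split_ifs with h
  · rw [ArithmeticFunction.vonMangoldt_apply_prime h]; ring
  · ring

lemma exists_abs_sum_primeLogCubeSub_le : ∃ C : ℝ, 0 < C ∧ ∀ N : ℕ, 2 ≤ N →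
    |∑ n ∈ Finset.Ioc 0 N, primeLogCubeSub n| ≤ C * (N * log N) := by
  obtain ⟨C, hC, h⟩ := exists_abs_sum_lambdaLogSq_le
  refine ⟨C + 32, by positivity, fun N hN => ?_⟩
  have hN1 : (1 : ℝ) ≤ N := by exact_mod_cast (by lia : 1 ≤ N)
  have hl : 0 ≤ log N := Real.log_nonneg hN1
  have hd : (∑ n ∈ Finset.Ioc 0 N, lambdaLogSq n) - ∑ n ∈ Finset.Ioc 0 N, primeLogCubeSub n =
      ∑ n ∈ Finset.Ioc 0 N with ¬ n.Prime, ArithmeticFunction.vonMangoldt n * log n ^ 2 := by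
    rw [← Finset.sum_sub_distrib, Finset.sum_filter]
    refine Finset.sum_congr rfl fun n _ => ?_
    rw [lambdaLogSq_sub_primeLogCubeSub]
    split_ifs <;> rfl
  have h0 : 0 ≤ ∑ n ∈ Finset.Ioc 0 N with ¬ n.Prime,
      ArithmeticFunction.vonMangoldt n * log n ^ 2 :=
    Finset.sum_nonneg fun n _ => mul_nonneg ArithmeticFunction.vonMangoldt_nonneg (sq_nonneg _)
  have h1 : ∑ n ∈ Finset.Ioc 0 N with ¬ n.Prime, ArithmeticFunction.vonMangoldt n * log n ^ 2 ≤
      (Chebyshev.psi N - Chebyshev.theta N) * log N ^ 2 := by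
    rw [Chebyshev.psi_sub_theta_eq_sum_not_prime, Nat.floor_natCast, Finset.sum_mul]
    refine Finset.sum_le_sum fun n hn => ?_
    simp only [Finset.mem_filter, Finset.mem_Ioc] at hn
    have hn0 : (1 : ℝ) ≤ n := by exact_mod_cast hn.1.1
    have := Real.log_nonneg hn0
    have hnN : (n : ℝ) ≤ N := by exact_mod_cast hn.1.2
    gcongr
  have h2 := Chebyshev.psi_sub_theta_le hN1
  have h3 : log N ^ 2 ≤ 16 * √N := by
    have hs : 0 < √√(N : ℝ) := by positivity
    have e : log N = 4 * log √√(N : ℝ) := by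
      rw [Real.log_sqrt (by positivity), Real.log_sqrt (by positivity)]; ring
    have h4 : log √√(N : ℝ) ≤ √√(N : ℝ) := by linarith [Real.log_le_sub_one_of_pos hs]
    have h5 : log N ≤ 4 * √√(N : ℝ) := by linarith
    calc log N ^ 2 ≤ (4 * √√(N : ℝ)) ^ 2 := by gcongr
      _ = 16 * √N := by rw [mul_pow, Real.sq_sqrt (by positivity)]; norm_num
  have h4 : (Chebyshev.psi N - Chebyshev.theta N) * log N ^ 2 ≤ 32 * (N * log N) := by
    calc _ ≤ (2 * √N * log N) * (16 * √N) := by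
          gcongr
      _ = 32 * (√N * √N * log N) := by ring
      _ = _ := by rw [Real.mul_self_sqrt (by positivity)]
  have h5 := abs_le.1 (h N hN)
  rw [abs_le]
  constructor <;> linarith

lemma sum_Ioc_sub_mul (B g : ℕ → ℝ) {M N : ℕ} (hMN : M ≤ N) :
    ∑ n ∈ Finset.Ioc M N, (B n - B (n - 1)) * g n =
      B N * g (N + 1) - B M * g (M + 1) +
        ∑ n ∈ Finset.Ioc M N, B n * (g n - g (n + 1)) := by
  induction N, hMN using Nat.le_induction with
  | base => simp
  | succ N hN ih =>
    rw [Finset.sum_Ioc_succ_top (by lia), Finset.sum_Ioc_succ_top (by lia), ih,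
      Nat.add_sub_cancel]
    ring

lemma abs_sum_Ioc_mul_le {b V g : ℕ → ℝ} {M N : ℕ} (hMN : M ≤ N)
    (hb : ∀ n, M ≤ n → |∑ k ∈ Finset.Ioc 0 n, b k| ≤ V n)
    (hg : ∀ n, M < n → g (n + 1) ≤ g n) (hg0 : ∀ n, M < n → 0 ≤ g n) :
    |∑ n ∈ Finset.Ioc M N, b n * g n| ≤
      2 * V M * g (M + 1) + ∑ n ∈ Finset.Ioc M N, (V n - V (n - 1)) * g n := by
  set B : ℕ → ℝ := fun n => ∑ k ∈ Finset.Ioc 0 n, b k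
  have e : ∑ n ∈ Finset.Ioc M N, b n * g n = ∑ n ∈ Finset.Ioc M N, (B n - B (n - 1)) * g n := by
    refine Finset.sum_congr rfl fun n hn => ?_
    rw [Finset.mem_Ioc] at hn
    obtain ⟨m, rfl⟩ : ∃ m, n = m + 1 := ⟨n - 1, by lia⟩
    simp only [B, Nat.add_sub_cancel, Finset.sum_Ioc_succ_top (Nat.zero_le m), add_sub_cancel_left]
  rw [e, sum_Ioc_sub_mul B g hMN, sum_Ioc_sub_mul V g hMN]
  have h1 : |B N * g (N + 1)| ≤ V N * g (N + 1) := by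
    have := hg0 (N + 1) (by lia)
    rw [abs_mul, abs_of_nonneg this]
    gcongr
    exact hb N hMN
  have h2 : |B M * g (M + 1)| ≤ V M * g (M + 1) := by
    have := hg0 (M + 1) (by lia)
    rw [abs_mul, abs_of_nonneg this]
    gcongr
    exact hb M le_rfl
  have h3 : |∑ n ∈ Finset.Ioc M N, B n * (g n - g (n + 1))| ≤
      ∑ n ∈ Finset.Ioc M N, V n * (g n - g (n + 1)) := by
    refine (Finset.abs_sum_le_sum_abs _ _).trans (Finset.sum_le_sum fun n hn => ?_)
    rw [Finset.mem_Ioc] at hn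
    have := sub_nonneg.2 (hg n hn.1)
    rw [abs_mul, abs_of_nonneg this]
    gcongr
    exact hb n hn.1.le
  rw [abs_le] at *
  constructor <;> linarith

lemma sum_Ioc_one_div_mul_sub_one_le {M N : ℕ} (hM : 1 ≤ M) (hMN : M ≤ N) :
    ∑ n ∈ Finset.Ioc M N, 1 / ((n : ℝ) * (n - 1)) ≤ 1 / M := by
  have : ∑ n ∈ Finset.Ioc M N, 1 / ((n : ℝ) * (n - 1)) = 1 / M - 1 / N := by
    induction N, hMN using Nat.le_induction with
    | base => simp
    | succ N hN ih =>
      rw [Finset.sum_Ioc_succ_top (by lia), ih]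
      have : (N : ℝ) ≠ 0 := by exact_mod_cast (by lia : N ≠ 0)
      have : (N : ℝ) + 1 ≠ 0 := by positivity
      push_cast
      rw [add_sub_cancel_right]
      field_simp
      ring
  rw [this]
  have : (0 : ℝ) ≤ 1 / N := by positivity
  linarith

lemma nat_mul_log_sub_mem {n : ℕ} (hn : 2 ≤ n) :
    log n ≤ n * log n - ((n : ℝ) - 1) * log ((n : ℝ) - 1) ∧
      n * log n - ((n : ℝ) - 1) * log ((n : ℝ) - 1) ≤ log n + 1 := by
  have hn' : (2 : ℝ) ≤ n := by exact_mod_cast hn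
  have h1 : log ((n : ℝ) - 1) ≤ log n := Real.log_le_log (by linarith) (by linarith)
  have h2 : log n - log ((n : ℝ) - 1) ≤ 1 / ((n : ℝ) - 1) := by
    rw [← Real.log_div (by linarith) (by linarith)]
    refine (Real.log_le_sub_one_of_pos (div_pos (by linarith) (by linarith))).trans (le_of_eq ?_)
    have : (n : ℝ) - 1 ≠ 0 := by linarith
    field_simp
    ring
  constructor
  · nlinarith
  · have h3 : ((n : ℝ) - 1) * (log n - log ((n : ℝ) - 1)) ≤ 1 := by
      calc _ ≤ ((n : ℝ) - 1) * (1 / ((n : ℝ) - 1)) := by gcongr; linarith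
        _ = 1 := mul_one_div_cancel (by linarith)
    linarith

lemma exists_abs_sum_primeLogCubeSub_div_le : ∃ C : ℝ, 0 < C ∧ ∀ M N : ℕ, 2 ≤ M → M ≤ N →
    |∑ n ∈ Finset.Ioc M N, primeLogCubeSub n * (1 / ((n : ℝ) ^ 2 * log n ^ 3))| ≤
      C / (M * log M ^ 2) := by
  obtain ⟨C, hC, h⟩ := exists_abs_sum_primeLogCubeSub_le
  refine ⟨4 * C, by positivity, fun M N hM hMN => ?_⟩
  have hM' : (2 : ℝ) ≤ M := by exact_mod_cast hM
  have hl : 0 < log M := Real.log_pos (by linarith)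
  refine (abs_sum_Ioc_mul_le (V := fun n => C * (n * log n))
    (g := fun n => 1 / ((n : ℝ) ^ 2 * log n ^ 3)) hMN (fun n hn => h n (by lia))
    (fun n hn => ?_) (fun n hn => ?_)).trans ?_
  · have hn : (2 : ℝ) < n := by exact_mod_cast (by lia : 2 < n)
    have : 0 < log n := Real.log_pos (by linarith)
    push_cast
    gcongr <;> linarith
  · have hn : (2 : ℝ) < n := by exact_mod_cast (by lia : 2 < n)
    have : 0 < log n := Real.log_pos (by linarith)
    positivity
  · have h1 : 2 * (C * (M * log M)) * (1 / (((M + 1 : ℕ) : ℝ) ^ 2 * log ((M + 1 : ℕ) : ℝ) ^ 3)) ≤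
        2 * C / (M * log M ^ 2) := by
      calc _ ≤ 2 * (C * (M * log M)) * (1 / ((M : ℝ) ^ 2 * log M ^ 3)) := by
            push_cast
            gcongr <;> linarith
        _ = _ := by field_simp
    have h2 : ∑ n ∈ Finset.Ioc M N, (C * (n * log n) - C * (((n - 1 : ℕ) : ℝ) *
        log ((n - 1 : ℕ) : ℝ))) * (1 / ((n : ℝ) ^ 2 * log n ^ 3)) ≤
        ∑ n ∈ Finset.Ioc M N, 2 * C / log M ^ 2 * (1 / ((n : ℝ) * (n - 1))) := by
      refine Finset.sum_le_sum fun n hn => ?_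
      rw [Finset.mem_Ioc] at hn
      have hn3 : (3 : ℝ) ≤ n := by exact_mod_cast (by lia : 3 ≤ n)
      have hnM : (M : ℝ) ≤ n := by exact_mod_cast hn.1.le
      have hln : 1 ≤ log n := by
        rw [Real.le_log_iff_exp_le (by linarith)]
        linarith [Real.exp_one_lt_d9]
      rw [Nat.cast_sub (by lia), Nat.cast_one, ← mul_sub]
      have := (nat_mul_log_sub_mem (n := n) (by lia)).2
      calc _ ≤ C * (2 * log n) * (1 / ((n : ℝ) ^ 2 * log n ^ 3)) := by
            gcongr
            linarith
        _ = 2 * C / log n ^ 2 * (1 / ((n : ℝ) * n)) := by field_simp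
        _ ≤ _ := by
            have : 0 < (n : ℝ) - 1 := by linarith
            gcongr
            linarith
    rw [← Finset.mul_sum] at h2
    have h3 := mul_le_mul_of_nonneg_left (sum_Ioc_one_div_mul_sub_one_le (by lia) hMN)
      (show 0 ≤ 2 * C / log M ^ 2 by positivity)
    have h4 : 2 * C / log M ^ 2 * (1 / M) = 2 * C / (M * log M ^ 2) := by field_simp
    have h5 : 4 * C / (M * log M ^ 2) = 2 * C / (M * log M ^ 2) + 2 * C / (M * log M ^ 2) := by ring
    linarith

lemma abs_one_div_sub_sub_le {n : ℕ} (hn : 3 ≤ n) :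
    |1 / ((n : ℝ) ^ 2 * log n) - (1 / (((n : ℝ) - 1) * log ((n : ℝ) - 1)) - 1 / (n * log n))| ≤
      2 / log ((n : ℝ) - 1) ^ 2 * (1 / ((n : ℝ) * (n - 1))) := by
  have hn' : (3 : ℝ) ≤ n := by exact_mod_cast hn
  obtain ⟨h1, h2⟩ := nat_mul_log_sub_mem (n := n) (by lia)
  have hl0 : 0 < log ((n : ℝ) - 1) := Real.log_pos (by linarith)
  have hl1 : log ((n : ℝ) - 1) ≤ log n := Real.log_le_log (by linarith) (by linarith)
  have hl2 : log n ≤ n - 1 := Real.log_le_sub_one_of_pos (by linarith)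
  have hm : 0 < (n : ℝ) - 1 := by linarith
  have hl3 : 0 < log n := hl0.trans_le hl1
  set D := n * log n - ((n : ℝ) - 1) * log ((n : ℝ) - 1) with hD
  have e : 1 / ((n : ℝ) ^ 2 * log n) -
      (1 / (((n : ℝ) - 1) * log ((n : ℝ) - 1)) - 1 / (n * log n)) =
      -((n * (D - log n) + D) / (n ^ 2 * ((n : ℝ) - 1) * log n * log ((n : ℝ) - 1))) := by
    rw [hD]
    field_simp
    ring
  have h3 : 0 ≤ n * (D - log n) + D := by nlinarith
  have h4 : n * (D - log n) + D ≤ 2 * n := by nlinarith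
  rw [e, abs_neg, abs_of_nonneg (by positivity)]
  calc _ ≤ 2 * n / (n ^ 2 * ((n : ℝ) - 1) * log ((n : ℝ) - 1) * log ((n : ℝ) - 1)) := by gcongr
    _ = _ := by field_simp

lemma abs_sum_one_div_sq_mul_log_sub_le {M N : ℕ} (hM : 2 ≤ M) (hMN : M ≤ N) :
    |∑ n ∈ Finset.Ioc M N, 1 / ((n : ℝ) ^ 2 * log n) - (1 / (M * log M) - 1 / (N * log N))| ≤
      2 / (M * log M ^ 2) := by
  have hM' : (2 : ℝ) ≤ M := by exact_mod_cast hM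
  have hl : 0 < log M := Real.log_pos (by linarith)
  have e : ∑ n ∈ Finset.Ioc M N, (1 / (((n : ℝ) - 1) * log ((n : ℝ) - 1)) - 1 / (n * log n)) =
      1 / (M * log M) - 1 / (N * log N) := by
    induction N, hMN using Nat.le_induction with
    | base => simp
    | succ N hN ih =>
      rw [Finset.sum_Ioc_succ_top (by lia), ih]
      push_cast
      rw [add_sub_cancel_right]
      ring
  rw [← e, ← Finset.sum_sub_distrib]
  refine (Finset.abs_sum_le_sum_abs _ _).trans ?_
  calc _ ≤ ∑ n ∈ Finset.Ioc M N, 2 / log M ^ 2 * (1 / ((n : ℝ) * (n - 1))) := by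
        refine Finset.sum_le_sum fun n hn => ?_
        rw [Finset.mem_Ioc] at hn
        have hnM : (M : ℝ) ≤ n - 1 := by
          have : ((M + 1 : ℕ) : ℝ) ≤ n := by exact_mod_cast hn.1
          push_cast at this
          linarith
        have : 0 ≤ 1 / ((n : ℝ) * (n - 1)) :=
          one_div_nonneg.2 (mul_nonneg (by linarith) (by linarith))
        refine (abs_one_div_sub_sub_le (by lia)).trans ?_
        gcongr
    _ ≤ 2 / log M ^ 2 * (1 / M) := by
        rw [← Finset.mul_sum]
        gcongr
        exact sum_Ioc_one_div_mul_sub_one_le (by lia) hMN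
    _ = _ := by field_simp

lemma exists_abs_sum_prime_one_div_sq_sub_le : ∃ C : ℝ, 0 < C ∧ ∀ M N : ℕ, 2 ≤ M → M ≤ N →
    |(∑ p ∈ Finset.Ioc M N with p.Prime, 1 / (p : ℝ) ^ 2) -
      (1 / (M * log M) - 1 / (N * log N))| ≤ C / (M * log M ^ 2) := by
  obtain ⟨C, hC, h⟩ := exists_abs_sum_primeLogCubeSub_div_le
  refine ⟨C + 2, by positivity, fun M N hM hMN => ?_⟩
  have e : ∑ n ∈ Finset.Ioc M N, primeLogCubeSub n * (1 / ((n : ℝ) ^ 2 * log n ^ 3)) =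
      (∑ p ∈ Finset.Ioc M N with p.Prime, 1 / (p : ℝ) ^ 2) -
        ∑ n ∈ Finset.Ioc M N, 1 / ((n : ℝ) ^ 2 * log n) := by
    rw [Finset.sum_filter, ← Finset.sum_sub_distrib]
    refine Finset.sum_congr rfl fun n hn => ?_
    rw [Finset.mem_Ioc] at hn
    have hn : (2 : ℝ) < n := by exact_mod_cast (by lia : 2 < n)
    have : 0 < log n := Real.log_pos (by linarith)
    rw [primeLogCubeSub]
    split_ifs
    · field_simp
    · field_simp
      ring
  have h1 := abs_le.1 (h M N hM hMN)
  have h2 := abs_le.1 (abs_sum_one_div_sq_mul_log_sub_le hM hMN)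
  rw [e] at h1
  rw [add_div, abs_le]
  constructor <;> linarith

lemma abs_one_div_floor_mul_log_sub_le {y : ℝ} (hy : 2 ≤ y) :
    |1 / (⌊y⌋₊ * log ⌊y⌋₊) - 1 / (y * log y)| ≤ 3 / (⌊y⌋₊ * log ⌊y⌋₊ ^ 2) := by
  have hM : 2 ≤ ⌊y⌋₊ := Nat.le_floor (by exact_mod_cast hy)
  have hMy := Nat.floor_le (show 0 ≤ y by linarith)
  have hyM := Nat.lt_floor_add_one y
  set M := ⌊y⌋₊
  have hM' : (2 : ℝ) ≤ M := by exact_mod_cast hM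
  have hl : 0 < log M := Real.log_pos (by linarith)
  have h1 := abs_le.1 (abs_sum_one_div_sq_mul_log_sub_le hM (Nat.le_succ M))
  rw [Finset.sum_Ioc_succ_top le_rfl, Finset.Ioc_self, Finset.sum_empty, zero_add] at h1
  push_cast at h1
  have hll : log M ≤ M := by linarith [Real.log_le_sub_one_of_pos (x := M) (by linarith)]
  have h2 : 1 / (((M : ℝ) + 1) ^ 2 * log ((M : ℝ) + 1)) ≤ 1 / (M * log M ^ 2) := by
    calc _ ≤ 1 / ((M : ℝ) ^ 2 * log M) := by gcongr <;> linarith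
      _ ≤ _ := by
        rw [show (M : ℝ) ^ 2 * log M = M * (log M * M) by ring,
          show (M : ℝ) * log M ^ 2 = M * (log M * log M) by ring]
        gcongr
  have h3 : 1 / (((M : ℝ) + 1) * log ((M : ℝ) + 1)) ≤ 1 / (y * log y) := by
    have : 0 < log y := Real.log_pos (by linarith)
    gcongr
  have h4 : 1 / (y * log y) ≤ 1 / (M * log M) := by gcongr
  have h5 : 3 / (M * log M ^ 2) = 1 / (M * log M ^ 2) + 2 / (M * log M ^ 2) := by ring
  rw [h5, abs_of_nonneg (by linarith)]
  linarith

lemma one_div_floor_mul_log_sq_le {y : ℝ} (hy : 2 ≤ y) :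
    1 / (⌊y⌋₊ * log ⌊y⌋₊ ^ 2) ≤ 8 / (y * log y ^ 2) := by
  have hM : 2 ≤ ⌊y⌋₊ := Nat.le_floor (by exact_mod_cast hy)
  have hyM := Nat.lt_floor_add_one y
  set M := ⌊y⌋₊
  have hM' : (2 : ℝ) ≤ M := by exact_mod_cast hM
  have hl : 0 < log M := Real.log_pos (by linarith)
  have hly : 0 < log y := Real.log_pos (by linarith)
  have h2 : y ≤ 2 * M := by linarith
  have h1 : log y ≤ 2 * log M := by
    calc log y ≤ log (2 * M) := Real.log_le_log (by linarith) h2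
      _ = log 2 + log M := Real.log_mul (by norm_num) (by linarith)
      _ ≤ _ := by linarith [Real.log_le_log two_pos hM']
  calc 1 / (M * log M ^ 2) = 8 / (2 * M * (2 * log M) ^ 2) := by field_simp; norm_num
    _ ≤ _ := by gcongr

lemma filter_prime_sqrt_lt_eq {x : ℝ} :
    Finset.filter (fun p => Nat.Prime p ∧ √x < (p : ℝ)) (Finset.Iic ⌊x⌋₊) =
      (Finset.Ioc ⌊√x⌋₊ ⌊x⌋₊).filter Nat.Prime := by
  ext p
  simp only [Finset.mem_filter, Finset.mem_Iic, Finset.mem_Ioc, ← Nat.floor_lt (sqrt_nonneg x)]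
  tauto

/-- `∑_{√x < p ≤ x} 1/p² = 2/(√x log x) + O(1/(√x (log x)²))`, the sum being over
primes `p` with `√x < p ≤ x`. -/
theorem sum_one_div_sq_primes_between_sqrt :
    ∃ C : ℝ, 0 < C ∧ ∀ x : ℝ, 4 ≤ x →
      |(∑ p ∈ Finset.filter (fun p => Nat.Prime p ∧ Real.sqrt x < (p : ℝ))
            (Finset.Iic ⌊x⌋₊), (1 : ℝ) / (p : ℝ) ^ 2) -
          2 / (Real.sqrt x * Real.log x)| ≤
        C / (Real.sqrt x * (Real.log x) ^ 2) := by
  obtain ⟨C, hC, h⟩ := exists_abs_sum_prime_one_div_sq_sub_le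
  refine ⟨32 * (C + 4), by positivity, fun x hx => ?_⟩
  rw [filter_prime_sqrt_lt_eq]
  have hx0 : 0 ≤ x := by linarith
  obtain ⟨y, hy⟩ : ∃ y, y = √x := ⟨_, rfl⟩
  have hy2 : 2 ≤ y := by
    rw [hy, Real.le_sqrt' two_pos]; linarith
  have hxy : x = y * y := by rw [hy, Real.mul_self_sqrt hx0]
  have hlx : log x = 2 * log y := by rw [hxy, Real.log_mul (by linarith) (by linarith)]; ring
  have hyx : y ≤ x := by nlinarith
  have hly : 0 < log y := Real.log_pos (by linarith)
  rw [← hy, hlx]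
  have hM : 2 ≤ ⌊y⌋₊ := Nat.le_floor (by exact_mod_cast hy2)
  have hMN : ⌊y⌋₊ ≤ ⌊x⌋₊ := Nat.floor_mono hyx
  have hMM : ⌊y⌋₊ * ⌊y⌋₊ ≤ ⌊x⌋₊ := by
    refine Nat.le_floor ?_
    push_cast
    rw [hxy]
    have := Nat.floor_le (show 0 ≤ y by linarith)
    gcongr
  have h1 := abs_le.1 (h _ _ hM hMN)
  have h2 := abs_le.1 (abs_one_div_floor_mul_log_sub_le hy2)
  have h3 := one_div_floor_mul_log_sq_le hy2
  set M := ⌊y⌋₊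
  set N := ⌊x⌋₊
  have hM' : (2 : ℝ) ≤ M := by exact_mod_cast hM
  have hMN' : (M : ℝ) ≤ N := by exact_mod_cast hMN
  have hMM' : (M : ℝ) * M ≤ N := by exact_mod_cast hMM
  have hl : 0 < log M := Real.log_pos (by linarith)
  have hll : log M ≤ M := by linarith [Real.log_le_sub_one_of_pos (x := M) (by linarith)]
  have h4 : 1 / (N * log N) ≤ 1 / (M * log M ^ 2) := by
    rw [show (M : ℝ) * log M ^ 2 = M * log M * log M by ring]
    have : (M : ℝ) * log M ≤ N := le_trans (by gcongr) hMM'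
    gcongr
  have h5 : 0 ≤ 1 / (N * log N) :=
    one_div_nonneg.2 (mul_nonneg (by positivity) (Real.log_nonneg (by linarith)))
  have h6 : 2 / (y * (2 * log y)) = 1 / (y * log y) := by field_simp
  have h7 : 32 * (C + 4) / (y * (2 * log y) ^ 2) = (C + 4) * (8 / (y * log y ^ 2)) := by
    field_simp; norm_num
  have h8 := mul_le_mul_of_nonneg_left h3 (show 0 ≤ C + 4 by positivity)
  rw [div_eq_mul_one_div C] at h1
  rw [div_eq_mul_one_div 3] at h2
  rw [h6, h7, abs_le]
  constructor <;> linarith
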